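/- arXiv:math/9411221 — 3 statements merged into one kernel-verified Lean document; each statement's English description precedes it below -/
import Mathlib

section
/- Let 𝒢 = 𝒢(G,H,S) be a strongly connected, hierarchical Cayley coset digraph whose generators are distinct double-coset representatives, with the generators ordered as s₁,…,s_k (k ≥ 2) so that the subgroups G_i = ⟨H ∪ {s₁,…,s_i}⟩ are pairwise distinct. Let d_i = d_{s₁} + … + d_{s_i}. Suppose d_{s_{i+1}} ≤ d_i for each i < k, and |G₁/H| ≥ d₂. Then κ(𝒢) = d(𝒢) = Σ_{s∈S} d_s. -/
open Classical

/-- A digraph (given by its edge relation `E`) is strongly connected iff for every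
ordered pair of vertices there is a directed path from the first to the second. -/
def SC {V : Type*} (E : V → V → Prop) : Prop :=
  ∀ a b : V, Relation.ReflTransGen E a b

/-- The subdigraph induced on `A` is strongly connected. -/
def SCOn {V : Type*} (E : V → V → Prop) (A : Set V) : Prop :=
  ∀ a ∈ A, ∀ b ∈ A, Relation.ReflTransGen (fun x y => x ∈ A ∧ y ∈ A ∧ E x y) a b

/-- Out-neighborhood of a set of vertices. -/
def Nout {V : Type*} (E : V → V → Prop) (A : Set V) : Set V :=
  {x | x ∉ A ∧ ∃ y ∈ A, E y x}

/-- Vertex connectivity: the least cardinality of a set `T` of vertices whose removal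
leaves a non-strongly-connected digraph; `Nat.card V - 1` if no such `T` exists. -/
noncomputable def kappa {V : Type*} [Finite V] (E : V → V → Prop) : ℕ :=
  if ∃ T : Set V, ¬ SCOn E Tᶜ then
    sInf {m | ∃ T : Set V, T.ncard = m ∧ ¬ SCOn E Tᶜ}
  else Nat.card V - 1

/-- A part of a digraph. -/
def IsPart {V : Type*} (E : V → V → Prop) (A : Set V) : Prop :=
  A.Nonempty ∧ ((A ∪ Nout E A)ᶜ : Set V).Nonempty

/-- An atom: a part with `|N(A)| = κ` of minimum cardinality among such parts. -/
def IsAtomD {V : Type*} [Finite V] (E : V → V → Prop) (A : Set V) : Prop :=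
  IsPart E A ∧ (Nout E A).ncard = kappa E ∧
    ∀ B : Set V, IsPart E B → (Nout E B).ncard = kappa E → A.ncard ≤ B.ncard
/-- The double coset `K s K`. -/
def dcoset {G : Type*} [Group G] (K : Subgroup G) (s : G) : Set G :=
  {g | ∃ h₁ ∈ K, ∃ h₂ ∈ K, g = h₁ * s * h₂}

/-- Edge relation of the Cayley coset digraph `𝒢(G,H,S)` on the left cosets `G ⧸ H`:
there is an edge from `g₁H` to `g₂H` iff `g₁⁻¹g₂ ∈ HsH` for some `s ∈ S`
(equivalently, `g₁Hs ∩ g₂H ≠ ∅`). -/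
def cayleyRel {G : Type*} [Group G] (H : Subgroup G) (S : Set G) :
    G ⧸ H → G ⧸ H → Prop :=
  fun x y => ∃ s ∈ S, ∃ g₁ g₂ : G, (g₁ : G ⧸ H) = x ∧ (g₂ : G ⧸ H) = y ∧
    g₁⁻¹ * g₂ ∈ dcoset H s

/-- `d_s = |HsH/H|`, the number of left cosets of `H` contained in `HsH`. -/
noncomputable def dval {G : Type*} [Group G] (H : Subgroup G) (s : G) : ℕ :=
  ((QuotientGroup.mk '' dcoset H s : Set (G ⧸ H))).ncard

/-- `Gᵢ = ⟨H ∪ {s₁,…,sᵢ}⟩` for an ordered list of generators. -/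
def towerGroup1 {G : Type*} [Group G] [DecidableEq G] (H : Subgroup G)
    (s : ℕ → G) (i : ℕ) : Subgroup G :=
  Subgroup.closure ((H : Set G) ∪ ((Finset.Icc 1 i).image s : Finset G))


open scoped Pointwise

section Isoperimetric

variable {G : Type*} [Group G]

/-- `X` is nonempty, `X * D` is not everything, and `X * D` has at most `m` elements more
than `X`. -/
def IsFragment (D : Set G) (m : ℕ) (X : Set G) : Prop :=
  X.Nonempty ∧ X * D ≠ Set.univ ∧ (X * D).ncard ≤ X.ncard + m

theorem ncard_smul_set (g : G) (X : Set G) : (g • X).ncard = X.ncard :=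
  Set.ncard_image_of_injective X (MulAction.injective g)

theorem IsFragment.smul {D : Set G} {m : ℕ} {X : Set G} (h : IsFragment D m X) (g : G) :
    IsFragment D m (g • X) := by
  obtain ⟨h1, h2, h3⟩ := h
  refine ⟨h1.smul_set, fun h => h2 ?_, ?_⟩
  · rw [smul_mul_assoc] at h
    rw [← inv_smul_smul g (X * D), h, Set.smul_set_univ]
  · rwa [smul_mul_assoc, ncard_smul_set, ncard_smul_set]

variable [Finite G]

theorem ncard_inter_mul_add_ncard_union_mul_le (A B D : Set G) :
    ((A ∩ B) * D).ncard + ((A ∪ B) * D).ncard ≤ (A * D).ncard + (B * D).ncard := by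
  have h1 : ((A ∩ B) * D).ncard ≤ ((A * D) ∩ (B * D)).ncard :=
    Set.ncard_le_ncard Set.inter_mul_subset (Set.toFinite _)
  have h2 := Set.ncard_union_add_ncard_inter (A * D) (B * D) (Set.toFinite _) (Set.toFinite _)
  rw [Set.union_mul]
  omega

theorem IsFragment.compl {D : Set G} {m : ℕ} {X : Set G} (h : IsFragment D m X) :
    IsFragment D⁻¹ m (X * D)ᶜ := by
  obtain ⟨h1, h2, h3⟩ := h
  have hsub : (X * D)ᶜ * D⁻¹ ⊆ Xᶜ := by
    rintro _ ⟨y, hy, d, hd, rfl⟩ hx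
    exact hy ⟨y * d, hx, d⁻¹, hd, by simp⟩
  refine ⟨Set.nonempty_compl.2 h2, fun h => ?_, ?_⟩
  · obtain ⟨x, hx⟩ := h1
    exact hsub (h ▸ Set.mem_univ x) hx
  · have e1 := Set.ncard_le_ncard hsub (Set.toFinite _)
    have e2 := Set.ncard_add_ncard_compl X
    have e3 := Set.ncard_add_ncard_compl (X * D)
    omega

/-- A fragment of least size containing `1` is stable under translation by its elements. -/
theorem smul_eq_self_of_minimal_fragment {D : Set G} {m : ℕ} {A : Set G}
    (hlow : ∀ X : Set G, X.Nonempty → X * D ≠ Set.univ → X.ncard + m ≤ (X * D).ncard)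
    (hA : IsFragment D m A)
    (hmin : ∀ X, IsFragment D m X → A.ncard ≤ X.ncard)
    (hmin' : ∀ X, IsFragment D⁻¹ m X → A.ncard ≤ X.ncard)
    (h1 : (1 : G) ∈ A) {g : G} (hg : g ∈ A) : g • A = A := by
  have hB := hA.smul g
  have hBc := ncard_smul_set g A
  set B := g • A with hBdef
  have hgB : g ∈ B := ⟨1, h1, by simp⟩
  have hne : (A ∩ B).Nonempty := ⟨g, hg, hgB⟩
  have hABD : (A ∩ B) * D ≠ Set.univ := fun h =>
    hA.2.1 (Set.eq_univ_of_univ_subset (h ▸ Set.mul_subset_mul_right Set.inter_subset_left))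
  have e1 := hlow _ hne hABD
  have e2 := ncard_inter_mul_add_ncard_union_mul_le A B D
  have e3 := Set.ncard_union_add_ncard_inter A B (Set.toFinite _) (Set.toFinite _)
  have e4 := hA.2.2
  have e5 := hB.2.2
  by_cases hU : (A ∪ B) * D = Set.univ
  · have e6 := hmin' _ hB.compl
    have e7 := Set.ncard_add_ncard_compl (B * D)
    have e8 := hlow B hB.1 hB.2.1
    rw [hU, Set.ncard_univ] at e2
    have e9 := (Set.ncard_pos (Set.toFinite (A ∩ B))).2 hne
    omega
  · have e6 := hlow _ (hne.mono (Set.inter_subset_left.trans Set.subset_union_left)) hU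
    have e7 := hmin (A ∩ B) ⟨hne, hABD, by omega⟩
    have e8 : A ∩ B = A :=
      Set.eq_of_subset_of_ncard_le Set.inter_subset_left e7 (Set.toFinite _)
    exact (Set.eq_of_subset_of_ncard_le (Set.inter_eq_left.1 e8) hBc.le (Set.toFinite _)).symm

theorem exists_subgroup_isFragment {H : Subgroup G} {D : Set G} (hHD : (H : Set G) * D = D)
    {m : ℕ} {A : Set G}
    (hlow : ∀ X : Set G, X.Nonempty → X * D ≠ Set.univ → X.ncard + m ≤ (X * D).ncard)
    (hA : IsFragment D m A)
    (hmin : ∀ X, IsFragment D m X → A.ncard ≤ X.ncard)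
    (hmin' : ∀ X, IsFragment D⁻¹ m X → A.ncard ≤ X.ncard) :
    ∃ K : Subgroup G, H ≤ K ∧ IsFragment D m (K : Set G) := by
  obtain ⟨a, ha⟩ := hA.1
  have hB := hA.smul a⁻¹
  have hBc := ncard_smul_set a⁻¹ A
  have h1 : (1 : G) ∈ a⁻¹ • A := ⟨a, ha, by simp⟩
  have hst : ∀ g ∈ a⁻¹ • A, g • (a⁻¹ • A) = a⁻¹ • A := fun g hg =>
    smul_eq_self_of_minimal_fragment hlow hB (hBc ▸ hmin) (hBc ▸ hmin') h1 hg
  generalize a⁻¹ • A = B at hB h1 hst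
  let K : Subgroup G :=
    { carrier := B
      one_mem' := h1
      mul_mem' := fun {x y} hx hy => by
        rw [← hst x hx]; exact ⟨y, hy, rfl⟩
      inv_mem' := fun {x} hx => by
        have h : (1 : G) ∈ x • B := by rw [hst x hx]; exact h1
        obtain ⟨y, hy, hxy⟩ := h
        rwa [← eq_inv_of_mul_eq_one_right hxy] }
  refine ⟨K, fun h hh => ?_, hB⟩
  have hKH : (K : Set G) * H * D = K * D := by rw [mul_assoc, hHD]
  have e1 := hlow (K * H) ⟨1, 1, K.one_mem, 1, H.one_mem, by simp⟩ (hKH ▸ hB.2.1)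
  have e2 : ((K : Set G) * D).ncard ≤ (K : Set G).ncard + m := hB.2.2
  rw [hKH] at e1
  have e3 : (K : Set G) = K * H :=
    Set.eq_of_subset_of_ncard_le (fun x hx => ⟨x, hx, 1, H.one_mem, by simp⟩)
      (by omega) (Set.toFinite _)
  have : h ∈ (K : Set G) * H := ⟨1, K.one_mem, h, hh, by simp⟩
  rwa [← e3] at this

/-- Hamidoune's principle: the isoperimetric inequality for `D` need only be checked on
subgroups, for both `D` and `D⁻¹`. -/
theorem add_le_ncard_mul_of_subgroups {H : Subgroup G} {D : Set G} (hHD : (H : Set G) * D = D)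
    (hDH : D * (H : Set G) = D) (hD1 : (1 : G) ∈ D) {c : ℕ}
    (hK : ∀ K : Subgroup G, H ≤ K → (K : Set G) * D ≠ Set.univ →
      (K : Set G).ncard + c ≤ ((K : Set G) * D).ncard)
    (hK' : ∀ K : Subgroup G, H ≤ K → (K : Set G) * D⁻¹ ≠ Set.univ →
      (K : Set G).ncard + c ≤ ((K : Set G) * D⁻¹).ncard)
    {X : Set G} (hX : X.Nonempty) (hXD : X * D ≠ Set.univ) :
    X.ncard + c ≤ (X * D).ncard := by
  by_contra! hlt
  have hXle : X.ncard ≤ (X * D).ncard :=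
    Set.ncard_le_ncard (fun x hx => ⟨x, hx, 1, hD1, by simp⟩) (Set.toFinite _)
  have hex : ∃ m, ∃ Y, IsFragment D m Y := ⟨_, X, hX, hXD, hlt.le⟩
  obtain ⟨m, ⟨Y, hY⟩, hmmin⟩ :
      ∃ m, (∃ Y, IsFragment D m Y) ∧ ∀ n Y, IsFragment D n Y → m ≤ n :=
    ⟨Nat.find hex, Nat.find_spec hex, fun n Y h => Nat.find_min' hex ⟨Y, h⟩⟩
  have hmc : m < c := by
    have := hmmin _ X ⟨hX, hXD, Nat.sub_le_iff_le_add'.1 le_rfl⟩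
    omega
  have hlow : ∀ Z : Set G, Z.Nonempty → Z * D ≠ Set.univ → Z.ncard + m ≤ (Z * D).ncard := by
    intro Z hZ hZD
    have h1 := hmmin _ Z ⟨hZ, hZD, Nat.sub_le_iff_le_add'.1 le_rfl⟩
    have h2 : Z.ncard ≤ (Z * D).ncard :=
      Set.ncard_le_ncard (fun x hx => ⟨x, hx, 1, hD1, by simp⟩) (Set.toFinite _)
    omega
  have hlow' : ∀ Z : Set G, Z.Nonempty → Z * D⁻¹ ≠ Set.univ →
      Z.ncard + m ≤ (Z * D⁻¹).ncard := by
    intro Z hZ hZD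
    have hf : IsFragment D⁻¹ ((Z * D⁻¹).ncard - Z.ncard) Z :=
      ⟨hZ, hZD, Nat.sub_le_iff_le_add'.1 le_rfl⟩
    have h1 := hmmin _ _ (inv_inv D ▸ hf.compl)
    have h2 : Z.ncard ≤ (Z * D⁻¹).ncard :=
      Set.ncard_le_ncard (fun x hx => ⟨x, hx, 1, by simpa using hD1, by simp⟩) (Set.toFinite _)
    omega
  have hHD' : (H : Set G) * D⁻¹ = D⁻¹ := by
    rw [← inv_inj, mul_inv_rev, inv_inv, inv_coe_set, hDH]
  have hexn : ∃ n, ∃ Z : Set G, Z.ncard = n ∧ (IsFragment D m Z ∨ IsFragment D⁻¹ m Z) :=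
    ⟨_, Y, rfl, Or.inl hY⟩
  obtain ⟨A, hA, hAmin⟩ : ∃ A : Set G, (IsFragment D m A ∨ IsFragment D⁻¹ m A) ∧
      ∀ Z, (IsFragment D m Z ∨ IsFragment D⁻¹ m Z) → A.ncard ≤ Z.ncard := by
    obtain ⟨A, hA1, hA2⟩ := Nat.find_spec hexn
    exact ⟨A, hA2, fun Z hZ => hA1 ▸ Nat.find_min' hexn ⟨Z, rfl, hZ⟩⟩
  rcases hA with hA | hA
  · obtain ⟨K, hHK, hf⟩ := exists_subgroup_isFragment hHD hlow hA
      (fun Z hZ => hAmin Z (Or.inl hZ)) (fun Z hZ => hAmin Z (Or.inr hZ))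
    have e1 := hK K hHK hf.2.1
    have e2 := hf.2.2
    omega
  · obtain ⟨K, hHK, hf⟩ := exists_subgroup_isFragment hHD' hlow' hA
      (fun Z hZ => hAmin Z (Or.inr hZ)) (fun Z hZ => hAmin Z (Or.inl (inv_inv D ▸ hZ)))
    have e1 := hK' K hHK hf.2.1
    have e2 := hf.2.2
    omega

end Isoperimetric
section DoubleCosets

variable {G : Type*} [Group G]

theorem self_mem_dcoset (H : Subgroup G) (s : G) : s ∈ dcoset H s :=
  ⟨1, H.one_mem, 1, H.one_mem, by simp⟩

theorem dcoset_inv (H : Subgroup G) (s : G) : dcoset H s⁻¹ = (dcoset H s)⁻¹ := by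
  ext g
  constructor
  · rintro ⟨a, ha, b, hb, rfl⟩
    exact ⟨b⁻¹, H.inv_mem hb, a⁻¹, H.inv_mem ha, by group⟩
  · rintro ⟨a, ha, b, hb, h⟩
    exact ⟨b⁻¹, H.inv_mem hb, a⁻¹, H.inv_mem ha, by rw [← inv_inv g, h]; group⟩

theorem ncard_dcoset_inv (H : Subgroup G) (s : G) :
    (dcoset H s⁻¹).ncard = (dcoset H s).ncard := by
  rw [dcoset_inv, ← Set.image_inv_eq_inv, Set.ncard_image_of_injective _ inv_injective]

theorem dcoset_subset {H K : Subgroup G} (hHK : H ≤ K) {s : G} (hs : s ∈ K) :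
    dcoset H s ⊆ K := by
  rintro _ ⟨a, ha, b, hb, rfl⟩
  exact K.mul_mem (K.mul_mem (hHK ha) hs) (hHK hb)

theorem notMem_of_mem_dcoset {H K : Subgroup G} (hHK : H ≤ K) {s g : G} (hs : s ∉ K)
    (hg : g ∈ dcoset H s) : g ∉ K := by
  obtain ⟨a, ha, b, hb, rfl⟩ := hg
  rwa [K.mul_mem_cancel_right (hHK hb), K.mul_mem_cancel_left (hHK ha)]

/-- The union of `H` and the first `i` double cosets `H s_j H`. -/
def doubleCosetUnion (H : Subgroup G) (s : ℕ → G) (i : ℕ) : Set G :=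
  H ∪ ⋃ j ∈ Finset.Icc 1 i, dcoset H (s j)

theorem mem_doubleCosetUnion {H : Subgroup G} {s : ℕ → G} {i : ℕ} {g : G} :
    g ∈ doubleCosetUnion H s i ↔ g ∈ H ∨ ∃ j ∈ Finset.Icc 1 i, g ∈ dcoset H (s j) := by
  simp [doubleCosetUnion]

theorem doubleCosetUnion_zero (H : Subgroup G) (s : ℕ → G) :
    doubleCosetUnion H s 0 = H := by
  simp [doubleCosetUnion]

theorem doubleCosetUnion_succ (H : Subgroup G) (s : ℕ → G) (i : ℕ) :
    doubleCosetUnion H s (i + 1) = doubleCosetUnion H s i ∪ dcoset H (s (i + 1)) := by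
  rw [doubleCosetUnion, doubleCosetUnion,
    ← Finset.insert_Icc_right_eq_Icc_add_one (by omega : 1 ≤ i + 1), Finset.set_biUnion_insert,
    Set.union_assoc, Set.union_comm (dcoset H _)]

theorem one_mem_doubleCosetUnion (H : Subgroup G) (s : ℕ → G) (i : ℕ) :
    (1 : G) ∈ doubleCosetUnion H s i :=
  Or.inl H.one_mem

theorem doubleCosetUnion_inv (H : Subgroup G) (s : ℕ → G) (i : ℕ) :
    doubleCosetUnion H s⁻¹ i = (doubleCosetUnion H s i)⁻¹ := by
  ext g
  simp [mem_doubleCosetUnion, dcoset_inv]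

theorem doubleCosetUnion_mul (H : Subgroup G) (s : ℕ → G) (i : ℕ) :
    doubleCosetUnion H s i * (H : Set G) = doubleCosetUnion H s i := by
  refine Set.Subset.antisymm ?_ fun x hx => ⟨x, hx, 1, H.one_mem, by simp⟩
  rintro _ ⟨x, hx, h, hh, rfl⟩
  rw [mem_doubleCosetUnion] at hx ⊢
  rcases hx with hx | ⟨j, hj, a, ha, b, hb, rfl⟩
  · exact Or.inl (H.mul_mem hx hh)
  · exact Or.inr ⟨j, hj, a, ha, b * h, H.mul_mem hb hh, by group⟩

theorem mul_doubleCosetUnion (H : Subgroup G) (s : ℕ → G) (i : ℕ) :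
    (H : Set G) * doubleCosetUnion H s i = doubleCosetUnion H s i := by
  rw [← inv_inj, mul_inv_rev, inv_coe_set, ← doubleCosetUnion_inv, doubleCosetUnion_mul]

section Tower

variable [DecidableEq G] (H : Subgroup G) (s : ℕ → G)

theorem le_towerGroup1 (i : ℕ) : H ≤ towerGroup1 H s i := fun _ hh =>
  Subgroup.subset_closure (Or.inl hh)

theorem mem_towerGroup1 {i j : ℕ} (hj : j ∈ Finset.Icc 1 i) : s j ∈ towerGroup1 H s i :=
  Subgroup.subset_closure (Or.inr (Finset.mem_coe.2 (Finset.mem_image_of_mem s hj)))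

variable {H s} in
theorem towerGroup1_le_iff {i : ℕ} {K : Subgroup G} :
    towerGroup1 H s i ≤ K ↔ H ≤ K ∧ ∀ j ∈ Finset.Icc 1 i, s j ∈ K := by
  rw [towerGroup1, Subgroup.closure_le, Set.union_subset_iff]
  refine and_congr Iff.rfl ⟨fun h j hj => h (Finset.mem_coe.2 (Finset.mem_image_of_mem s hj)),
    fun h x hx => ?_⟩
  obtain ⟨j, hj, rfl⟩ := Finset.mem_image.1 (Finset.mem_coe.1 hx)
  exact h j hj

theorem towerGroup1_mono : Monotone (towerGroup1 H s) := fun _ j hij =>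
  towerGroup1_le_iff.2 ⟨le_towerGroup1 H s j, fun _ hl =>
    mem_towerGroup1 H s (Finset.Icc_subset_Icc_right hij hl)⟩

variable {H s} in
theorem towerGroup1_succ_le {i : ℕ} {K : Subgroup G} (hK : towerGroup1 H s i ≤ K)
    (hs : s (i + 1) ∈ K) : towerGroup1 H s (i + 1) ≤ K := by
  rw [towerGroup1_le_iff] at hK ⊢
  refine ⟨hK.1, fun j hj => ?_⟩
  rw [Finset.mem_Icc] at hj
  rcases hj.2.lt_or_eq with h | rfl
  · exact hK.2 j (Finset.mem_Icc.2 ⟨hj.1, by omega⟩)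
  · exact hs

theorem towerGroup1_inv (i : ℕ) : towerGroup1 H s⁻¹ i = towerGroup1 H s i := by
  refine le_antisymm (towerGroup1_le_iff.2 ⟨le_towerGroup1 H s i, fun j hj => ?_⟩)
    (towerGroup1_le_iff.2 ⟨le_towerGroup1 H s⁻¹ i, fun j hj => ?_⟩)
  · exact inv_mem (mem_towerGroup1 H s hj)
  · simpa using inv_mem (mem_towerGroup1 H s⁻¹ hj)

theorem doubleCosetUnion_subset_towerGroup1 (i : ℕ) :
    doubleCosetUnion H s i ⊆ towerGroup1 H s i := by
  intro g hg
  rcases mem_doubleCosetUnion.1 hg with hg | ⟨j, hj, hg⟩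
  · exact le_towerGroup1 H s i hg
  · exact dcoset_subset (le_towerGroup1 H s i) (mem_towerGroup1 H s hj) hg

end Tower

variable [Finite G]

theorem two_mul_ncard_le_of_lt {M L : Subgroup G} (h : M < L) :
    2 * (M : Set G).ncard ≤ (L : Set G).ncard := by
  have hlt : (M : Set G).ncard < (L : Set G).ncard :=
    Set.ncard_lt_ncard (SetLike.coe_ssubset_coe.2 h) (Set.toFinite _)
  obtain ⟨q, hq⟩ : (M : Set G).ncard ∣ (L : Set G).ncard := Subgroup.card_dvd_of_le h.le
  rw [hq] at hlt ⊢
  have : 2 ≤ q := by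
    by_contra! hq2
    interval_cases q <;> omega
  nlinarith

/-- The isoperimetric inequality on subgroups passes from `L` to a larger subgroup generated
by `L` and one further element `s`. -/
theorem add_le_ncard_mul_union_dcoset {H L L' : Subgroup G} {D : Set G} {s : G} {c : ℕ}
    (hHL : H ≤ L) (hsL : s ∉ L) (hLL' : ∀ K : Subgroup G, L ≤ K → s ∈ K → L' ≤ K)
    (hDL : D ⊆ L) (h1 : (1 : G) ∈ D) (hcL : c + (dcoset H s).ncard ≤ (L : Set G).ncard)
    (hsc : (dcoset H s).ncard ≤ c)
    (ih : ∀ K : Subgroup G, H ≤ K → K ≤ L → (K : Set G) * D ≠ L →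
      (K : Set G).ncard + c ≤ ((K : Set G) * D).ncard)
    {K : Subgroup G} (hHK : H ≤ K) (hKL' : K ≤ L')
    (hne : (K : Set G) * (D ∪ dcoset H s) ≠ L') :
    (K : Set G).ncard + (c + (dcoset H s).ncard) ≤ ((K : Set G) * (D ∪ dcoset H s)).ncard := by
  have hKs : ((fun x => x * s) '' (K : Set G)).ncard = (K : Set G).ncard :=
    Set.ncard_image_of_injective _ (mul_left_injective s)
  have hKsub : (K : Set G) ⊆ K * D := fun x hx => ⟨x, hx, 1, h1, by simp⟩
  rw [Set.mul_union] at hne ⊢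
  have hKssub : (fun x => x * s) '' (K : Set G) ⊆ K * dcoset H s := by
    rintro _ ⟨x, hx, rfl⟩
    exact ⟨x, hx, s, self_mem_dcoset H s, rfl⟩
  by_cases hLK : L ≤ K
  · have hsK : s ∉ K := fun hs => by
      have hKL : K = L' := le_antisymm hKL' (hLL' K hLK hs)
      subst hKL
      refine hne (Set.Subset.antisymm (Set.union_subset ?_ ?_) (hKsub.trans Set.subset_union_left))
      · rintro _ ⟨x, hx, d, hd, rfl⟩
        exact K.mul_mem hx (hLK (hDL hd))
      · rintro _ ⟨x, hx, d, hd, rfl⟩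
        exact K.mul_mem hx (dcoset_subset hHK hs hd)
    have hdisj : Disjoint (K : Set G) ((fun x => x * s) '' (K : Set G)) := by
      rw [Set.disjoint_left]
      rintro _ hx ⟨y, hy, rfl⟩
      exact hsK ((K.mul_mem_cancel_left hy).1 hx)
    have e1 := Set.ncard_union_eq hdisj (Set.toFinite _) (Set.toFinite _)
    have e2 := Set.ncard_le_ncard (Set.union_subset_union hKsub hKssub) (Set.toFinite _)
    have e3 : (L : Set G).ncard ≤ (K : Set G).ncard := Set.ncard_le_ncard hLK (Set.toFinite _)
    omega
  by_cases hKL : K ≤ L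
  · have hKDL : (K : Set G) * D ⊆ L := by
      rintro _ ⟨x, hx, d, hd, rfl⟩
      exact L.mul_mem (hKL hx) (hDL hd)
    have hdisj : Disjoint ((K : Set G) * D) (K * dcoset H s) := by
      rw [Set.disjoint_left]
      rintro _ hx ⟨y, hy, d, hd, rfl⟩
      exact notMem_of_mem_dcoset hHL hsL hd ((L.mul_mem_cancel_left (hKL hy)).1 (hKDL hx))
    rw [Set.ncard_union_eq hdisj (Set.toFinite _) (Set.toFinite _)]
    by_cases hKD : (K : Set G) * D = L
    · have e1 := Set.ncard_le_ncard hKssub (Set.toFinite _)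
      rw [hKD]
      omega
    · have e1 := ih K hHK hKL hKD
      have e2 : (dcoset H s).ncard ≤ ((K : Set G) * dcoset H s).ncard :=
        Set.ncard_le_ncard (fun x hx => ⟨1, K.one_mem, x, hx, by simp⟩) (Set.toFinite _)
      omega
  · obtain ⟨g, hgK, hgL⟩ := SetLike.not_le_iff_exists.1 hKL
    let M : Subgroup G := K ⊓ L
    have hMsub : (M : Set G) ⊆ M * D := fun x hx => ⟨x, hx, 1, h1, by simp⟩
    have hMD : (M : Set G) * D ⊆ L := by
      rintro _ ⟨x, hx, d, hd, rfl⟩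
      exact L.mul_mem hx.2 (hDL hd)
    set P : Set G := ((M : Set G) * D) \ M with hP
    have hPL : P ⊆ L := Set.sdiff_subset.trans hMD
    have hPK : ∀ x ∈ P, x ∉ K := fun x hx hxK => hx.2 ⟨hxK, hPL hx⟩
    have hPKD : P ⊆ K * D := Set.sdiff_subset.trans (Set.mul_subset_mul_right fun x hx => hx.1)
    have hd1 : Disjoint P (g • P) := by
      rw [Set.disjoint_left]
      rintro _ hx ⟨y, hy, rfl⟩
      exact hgL ((L.mul_mem_cancel_right (hPL hy)).1 (hPL hx))
    have hd2 : Disjoint (K : Set G) (P ∪ g • P) := by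
      rw [Set.disjoint_left]
      rintro x hx (hxP | ⟨y, hy, rfl⟩)
      · exact hPK x hxP hx
      · exact hPK y hy ((K.mul_mem_cancel_left hgK).1 hx)
    have hsub : (K : Set G) ∪ (P ∪ g • P) ⊆ K * D ∪ K * dcoset H s := by
      refine Set.union_subset (hKsub.trans Set.subset_union_left)
        (Set.union_subset (hPKD.trans Set.subset_union_left) ?_)
      rintro _ ⟨y, hy, rfl⟩
      obtain ⟨x, hx, d, hd, rfl⟩ := hPKD hy
      exact Or.inl ⟨g * x, K.mul_mem hgK hx, d, hd, by simp [mul_assoc]⟩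
    have e1 := Set.ncard_le_ncard hsub (Set.toFinite _)
    rw [Set.ncard_union_eq hd2 (Set.toFinite _) (Set.toFinite _),
      Set.ncard_union_eq hd1 (Set.toFinite _) (Set.toFinite _), ncard_smul_set] at e1
    have e2 : P.ncard + (M : Set G).ncard = ((M : Set G) * D).ncard :=
      Set.ncard_sdiff_add_ncard_of_subset hMsub (Set.toFinite _)
    by_cases hML : (M : Set G) * D = L
    · have hlt : M < L := lt_of_le_of_ne inf_le_right fun h => hLK (inf_eq_right.1 h)
      have e3 := two_mul_ncard_le_of_lt hlt
      rw [hML] at e2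
      omega
    · have e3 := ih M (le_inf hHK hHL) inf_le_right hML
      omega

variable [DecidableEq G]

theorem add_sum_le_ncard_mul_doubleCosetUnion {H : Subgroup G} {s : ℕ → G} {k : ℕ}
    (hnot : ∀ i, 1 ≤ i → i < k → s (i + 1) ∉ towerGroup1 H s i)
    (hdeg : ∀ i, 1 ≤ i → i < k →
      (dcoset H (s (i + 1))).ncard ≤ ∑ j ∈ Finset.Icc 1 i, (dcoset H (s j)).ncard)
    (hgrow : ∀ i, 1 ≤ i → i < k →
      ∑ j ∈ Finset.Icc 1 (i + 1), (dcoset H (s j)).ncard ≤ (towerGroup1 H s i : Set G).ncard)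
    {i : ℕ} (hi : 1 ≤ i) (hik : i ≤ k) {K : Subgroup G} (hHK : H ≤ K)
    (hK : K ≤ towerGroup1 H s i)
    (hne : (K : Set G) * doubleCosetUnion H s i ≠ towerGroup1 H s i) :
    (K : Set G).ncard + ∑ j ∈ Finset.Icc 1 i, (dcoset H (s j)).ncard ≤
      ((K : Set G) * doubleCosetUnion H s i).ncard := by
  induction i, hi using Nat.le_induction generalizing K with
  | base =>
    have hD := doubleCosetUnion_succ H s 0
    rw [doubleCosetUnion_zero, zero_add] at hD
    have hs : s 1 ∉ K := fun hs => by
      have hK' : towerGroup1 H s 1 ≤ K :=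
        towerGroup1_le_iff.2 ⟨hHK, fun j hj => by
          obtain rfl : j = 1 := by simpa using hj
          exact hs⟩
      obtain rfl := le_antisymm hK hK'
      refine hne (Set.Subset.antisymm ?_
        fun x hx => ⟨x, hx, 1, one_mem_doubleCosetUnion H s 1, by simp⟩)
      rintro _ ⟨x, hx, d, hd, rfl⟩
      exact mul_mem hx (doubleCosetUnion_subset_towerGroup1 H s 1 hd)
    have hdisj : Disjoint (K : Set G) (dcoset H (s 1)) :=
      Set.disjoint_right.2 fun x hx => notMem_of_mem_dcoset hHK hs hx
    rw [Finset.Icc_self, Finset.sum_singleton,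
      ← Set.ncard_union_eq hdisj (Set.toFinite _) (Set.toFinite _), hD]
    refine Set.ncard_le_ncard (Set.union_subset ?_ ?_) (Set.toFinite _)
    · exact fun x hx => ⟨x, hx, 1, Or.inl H.one_mem, by simp⟩
    · exact fun x hx => ⟨1, K.one_mem, x, Or.inr hx, by simp⟩
  | succ i hi ih =>
    have hg := hgrow i hi (by omega)
    rw [Finset.sum_Icc_succ_top (by omega)] at hg ⊢
    rw [doubleCosetUnion_succ] at hne ⊢
    exact add_le_ncard_mul_union_dcoset (le_towerGroup1 H s i) (hnot i hi (by omega))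
      (fun _ h1 h2 => towerGroup1_succ_le h1 h2) (doubleCosetUnion_subset_towerGroup1 H s i)
      (one_mem_doubleCosetUnion H s i) hg (hdeg i hi (by omega))
      (fun K h1 h2 h3 => ih (by omega) h1 h2 h3) hHK hK hne

theorem sum_ncard_dcoset_le_ncard_towerGroup1 {H : Subgroup G} {s : ℕ → G} {k : ℕ}
    (hnot : ∀ i, 1 ≤ i → i < k → s (i + 1) ∉ towerGroup1 H s i)
    (hdeg : ∀ i, 1 ≤ i → i < k →
      (dcoset H (s (i + 1))).ncard ≤ ∑ j ∈ Finset.Icc 1 i, (dcoset H (s j)).ncard)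
    (hcard : (dcoset H (s 1)).ncard + (dcoset H (s 2)).ncard ≤
      (towerGroup1 H s 1 : Set G).ncard)
    {i : ℕ} (hi : 1 ≤ i) (hik : i < k) :
    ∑ j ∈ Finset.Icc 1 (i + 1), (dcoset H (s j)).ncard ≤ (towerGroup1 H s i : Set G).ncard := by
  induction i, hi using Nat.le_induction with
  | base => simpa [Finset.sum_Icc_succ_top] using hcard
  | succ i hi ih =>
    have h1 := ih (by omega)
    have h2 := two_mul_ncard_le_of_lt (M := towerGroup1 H s i) (L := towerGroup1 H s (i + 1))
      (lt_of_le_of_ne (towerGroup1_mono H s (Nat.le_succ i)) fun h =>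
        hnot i hi (by omega) (h ▸ mem_towerGroup1 H s (by simp)))
    have h3 := hdeg (i + 1) (by omega) hik
    rw [Finset.sum_Icc_succ_top (by omega)]
    omega

end DoubleCosets

section Connectivity

variable {V : Type*} {E : V → V → Prop}

theorem exists_isPart_of_not_SCOn_compl {T : Set V} (hT : ¬ SCOn E Tᶜ) :
    ∃ A, IsPart E A ∧ Nout E A ⊆ T := by
  simp only [SCOn, not_forall] at hT
  obtain ⟨a, ha, b, hb, hab⟩ := hT
  let A : Set V := {x | Relation.ReflTransGen (fun x y => x ∈ Tᶜ ∧ y ∈ Tᶜ ∧ E x y) a x}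
  have hAT : A ⊆ Tᶜ := by
    intro x hx
    rcases Relation.ReflTransGen.cases_tail hx with rfl | ⟨y, -, hy⟩
    · exact ha
    · exact hy.2.1
  have hN : Nout E A ⊆ T := by
    rintro x ⟨hxA, y, hy, hyx⟩
    by_contra hxT
    exact hxA (Relation.ReflTransGen.tail hy ⟨hAT hy, hxT, hyx⟩)
  refine ⟨A, ⟨⟨a, Relation.ReflTransGen.refl⟩, b, ?_⟩, hN⟩
  rintro (h | h)
  · exact hab h
  · exact hb (hN h)

theorem IsPart.not_SCOn_compl_Nout {A : Set V} (hA : IsPart E A) : ¬ SCOn E (Nout E A)ᶜ := by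
  intro h
  obtain ⟨⟨a, ha⟩, b, hb⟩ := hA
  have hab := h a (fun h => h.1 ha) b fun h => hb (Or.inr h)
  refine hb (Or.inl ?_)
  clear hb
  induction hab with
  | refl => exact ha
  | tail _ hxy ih =>
    by_contra hy
    exact hxy.2.1 ⟨hy, _, ih, hxy.2.2⟩

theorem kappa_eq_of_isPart [Finite V] {d : ℕ}
    (hlow : ∀ A, IsPart E A → d ≤ (Nout E A).ncard)
    {A : Set V} (hA : IsPart E A) (hAd : (Nout E A).ncard ≤ d) : kappa E = d := by
  rw [kappa, if_pos ⟨_, hA.not_SCOn_compl_Nout⟩]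
  have hmem : (Nout E A).ncard ∈ {m | ∃ T : Set V, T.ncard = m ∧ ¬ SCOn E Tᶜ} :=
    ⟨_, rfl, hA.not_SCOn_compl_Nout⟩
  refine le_antisymm ((Nat.sInf_le hmem).trans hAd) (le_csInf ⟨_, hmem⟩ ?_)
  rintro _ ⟨T, rfl, hT⟩
  obtain ⟨B, hB, hBT⟩ := exists_isPart_of_not_SCOn_compl hT
  exact (hlow B hB).trans (Set.ncard_le_ncard hBT (Set.toFinite _))

end Connectivity

section CayleyCoset

variable {G : Type*} [Group G] {H : Subgroup G}

theorem ncard_preimage_mk (B : Set (G ⧸ H)) :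
    ((QuotientGroup.mk : G → G ⧸ H) ⁻¹' B).ncard = Nat.card H * B.ncard := by
  have := Nat.card_congr (QuotientGroup.preimageMkEquivSubgroupProdSet H B)
  rwa [Nat.card_prod] at this

theorem ncard_dcoset (H : Subgroup G) (s : G) :
    (dcoset H s).ncard = Nat.card H * dval H s := by
  rw [dval, ← ncard_preimage_mk]
  congr 1
  refine Set.Subset.antisymm (Set.subset_preimage_image _ _) ?_
  rintro g ⟨_, ⟨a, ha, b, hb, rfl⟩, hx⟩
  have hm := QuotientGroup.eq.1 hx
  exact ⟨a, ha, b * ((a * s * b)⁻¹ * g), H.mul_mem hb hm, by group⟩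

theorem cayleyRel_mk {S : Set G} {a b : G} :
    cayleyRel H S (a : G ⧸ H) (b : G ⧸ H) ↔ ∃ s ∈ S, a⁻¹ * b ∈ dcoset H s := by
  constructor
  · rintro ⟨s, hs, g₁, g₂, h₁, h₂, x, hx, y, hy, h⟩
    have h₁' := QuotientGroup.eq.1 h₁.symm
    have h₂' := QuotientGroup.eq.1 h₂
    refine ⟨s, hs, (a⁻¹ * g₁) * x, H.mul_mem h₁' hx, y * (g₂⁻¹ * b), H.mul_mem hy h₂', ?_⟩
    calc a⁻¹ * b = (a⁻¹ * g₁) * (g₁⁻¹ * g₂) * (g₂⁻¹ * b) := by group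
      _ = _ := by rw [h]; group
  · rintro ⟨s, hs, h⟩
    exact ⟨s, hs, a, b, rfl, rfl, h⟩

variable [DecidableEq G] {s : ℕ → G} {k : ℕ}

theorem cayleyRel_image_mk {a b : G} :
    cayleyRel H (((Finset.Icc 1 k).image s : Finset G) : Set G) (a : G ⧸ H) (b : G ⧸ H) ↔
      ∃ j ∈ Finset.Icc 1 k, a⁻¹ * b ∈ dcoset H (s j) := by
  rw [cayleyRel_mk]
  simp only [Finset.mem_coe, Finset.mem_image, exists_exists_and_eq_and]

theorem preimage_union_Nout (A : Set (G ⧸ H)) :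
    (QuotientGroup.mk : G → G ⧸ H) ⁻¹'
        (A ∪ Nout (cayleyRel H (((Finset.Icc 1 k).image s : Finset G) : Set G)) A) =
      ((QuotientGroup.mk : G → G ⧸ H) ⁻¹' A) * doubleCosetUnion H s k := by
  ext g
  constructor
  · rintro (hg | ⟨-, y, hy, hyg⟩)
    · exact ⟨g, hg, 1, one_mem_doubleCosetUnion H s k, by simp⟩
    · obtain ⟨y, rfl⟩ := QuotientGroup.mk_surjective y
      exact ⟨y, hy, y⁻¹ * g, mem_doubleCosetUnion.2 (Or.inr (cayleyRel_image_mk.1 hyg)),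
        by simp⟩
  · rintro ⟨x, hx, d, hd, rfl⟩
    rcases mem_doubleCosetUnion.1 hd with hd | hd
    · left
      simpa [QuotientGroup.mk_mul_of_mem x hd] using hx
    · by_cases hA : ((x * d : G) : G ⧸ H) ∈ A
      · exact Or.inl hA
      · exact Or.inr ⟨hA, x, hx, cayleyRel_image_mk.2 (by simpa using hd)⟩

theorem towerGroup1_eq_top_of_SC
    (hconn : SC (cayleyRel H (((Finset.Icc 1 k).image s : Finset G) : Set G))) :
    towerGroup1 H s k = ⊤ := by
  have key : ∀ x : G ⧸ H, Relation.ReflTransGen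
      (cayleyRel H (((Finset.Icc 1 k).image s : Finset G) : Set G)) ((1 : G) : G ⧸ H) x →
      ∀ g : G, (g : G ⧸ H) = x → g ∈ towerGroup1 H s k := by
    intro x hx
    induction hx with
    | refl =>
      intro g hg
      have := QuotientGroup.eq.1 hg.symm
      exact le_towerGroup1 H s k (by simpa using this)
    | @tail y z _ hyz ih =>
      rintro g rfl
      obtain ⟨y, rfl⟩ := QuotientGroup.mk_surjective y
      obtain ⟨j, hj, h⟩ := cayleyRel_image_mk.1 hyz
      have h1 := dcoset_subset (le_towerGroup1 H s k) (mem_towerGroup1 H s hj) h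
      simpa using mul_mem (ih y rfl) h1
  exact eq_top_iff.2 fun g _ => key g (hconn _ _) g rfl

variable [Finite G]

theorem ncard_Nout_singleton_le (x : G ⧸ H) :
    (Nout (cayleyRel H (((Finset.Icc 1 k).image s : Finset G) : Set G)) {x}).ncard ≤
      ∑ i ∈ Finset.Icc 1 k, dval H (s i) := by
  obtain ⟨x, rfl⟩ := QuotientGroup.mk_surjective x
  have hsub : Nout (cayleyRel H (((Finset.Icc 1 k).image s : Finset G) : Set G)) {(x : G ⧸ H)} ⊆
      (x • ·) '' ⋃ i ∈ Finset.Icc 1 k, (QuotientGroup.mk '' dcoset H (s i) : Set (G ⧸ H)) := by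
    rintro y ⟨-, z, rfl, hy⟩
    obtain ⟨y, rfl⟩ := QuotientGroup.mk_surjective y
    obtain ⟨j, hj, h⟩ := cayleyRel_image_mk.1 hy
    refine ⟨((x⁻¹ * y : G) : G ⧸ H), Set.mem_biUnion hj ⟨_, h, rfl⟩, ?_⟩
    change ((x * (x⁻¹ * y) : G) : G ⧸ H) = y
    simp
  refine (Set.ncard_le_ncard hsub (Set.toFinite _)).trans
    ((Set.ncard_image_le (Set.toFinite _)).trans ?_)
  exact Finset.set_ncard_biUnion_le _ _

end CayleyCoset

/-- Theorem (hierarchical, general): a hierarchical Cayley coset digraph with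
`d_{s_{i+1}} ≤ d_i` and `|G₁/H| ≥ d₂` is optimally vertex connected. -/
theorem stmt_13 {G : Type*} [Group G] [Finite G] [DecidableEq G] (H : Subgroup G)
    (k : ℕ) (hk : 2 ≤ k) (s : ℕ → G)
    (hSH : ∀ i ∈ Finset.Icc 1 k, s i ∉ H)
    (hdc : ∀ i ∈ Finset.Icc 1 k, ∀ j ∈ Finset.Icc 1 k, i ≠ j →
      dcoset H (s i) ≠ dcoset H (s j))
    (hconn : SC (cayleyRel H (((Finset.Icc 1 k).image s : Finset G) : Set G)))
    (hhier : ∀ i ∈ Finset.Icc 1 k, ∀ j ∈ Finset.Icc 1 k, i ≠ j →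
      towerGroup1 H s i ≠ towerGroup1 H s j)
    (hdeg : ∀ i, 1 ≤ i → i < k →
      dval H (s (i + 1)) ≤ ∑ j ∈ Finset.Icc 1 i, dval H (s j))
    (hcard : dval H (s 1) + dval H (s 2) ≤
      Nat.card (towerGroup1 H s 1 ⧸ H.subgroupOf (towerGroup1 H s 1))) :
    kappa (cayleyRel H (((Finset.Icc 1 k).image s : Finset G) : Set G)) =
      ∑ i ∈ Finset.Icc 1 k, dval H (s i) := by
  have hHpos : 0 < Nat.card H := Nat.card_pos
  have hsum : ∀ i, ∑ j ∈ Finset.Icc 1 i, (dcoset H (s j)).ncard =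
      Nat.card H * ∑ j ∈ Finset.Icc 1 i, dval H (s j) := fun i => by
    simp only [ncard_dcoset, Finset.mul_sum]
  have htop := towerGroup1_eq_top_of_SC hconn
  have hnot : ∀ i, 1 ≤ i → i < k → s (i + 1) ∉ towerGroup1 H s i := fun i hi hik hs =>
    hhier i (Finset.mem_Icc.2 ⟨hi, hik.le⟩) (i + 1) (Finset.mem_Icc.2 ⟨by omega, hik⟩)
      (by omega) (le_antisymm (towerGroup1_mono H s (Nat.le_succ i)) (towerGroup1_succ_le le_rfl hs))
  have hdeg' : ∀ i, 1 ≤ i → i < k →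
      (dcoset H (s (i + 1))).ncard ≤ ∑ j ∈ Finset.Icc 1 i, (dcoset H (s j)).ncard := by
    intro i hi hik
    rw [hsum, ncard_dcoset]
    exact Nat.mul_le_mul_left _ (hdeg i hi hik)
  have hcard' : (dcoset H (s 1)).ncard + (dcoset H (s 2)).ncard ≤
      (towerGroup1 H s 1 : Set G).ncard := by
    have h1 : Nat.card (towerGroup1 H s 1) = _ :=
      Subgroup.card_eq_card_quotient_mul_card_subgroup (H.subgroupOf (towerGroup1 H s 1))
    rw [Nat.card_congr (Subgroup.subgroupOfEquivOfLe (le_towerGroup1 H s 1)).toEquiv] at h1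
    rw [← Nat.card_coe_set_eq (towerGroup1 H s 1 : Set G), SetLike.coe_sort_coe, h1, ncard_dcoset,
      ncard_dcoset, ← mul_add, mul_comm]
    exact Nat.mul_le_mul_right _ hcard
  have hgrow : ∀ i, 1 ≤ i → i < k →
      ∑ j ∈ Finset.Icc 1 (i + 1), (dcoset H (s j)).ncard ≤ (towerGroup1 H s i : Set G).ncard :=
    fun i hi hik => sum_ncard_dcoset_le_ncard_towerGroup1 hnot hdeg' hcard' hi hik
  have hiso : ∀ X : Set G, X.Nonempty → X * doubleCosetUnion H s k ≠ Set.univ →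
      X.ncard + ∑ j ∈ Finset.Icc 1 k, (dcoset H (s j)).ncard ≤
        (X * doubleCosetUnion H s k).ncard := by
    refine fun X hX hXD => add_le_ncard_mul_of_subgroups (mul_doubleCosetUnion H s k)
      (doubleCosetUnion_mul H s k) (one_mem_doubleCosetUnion H s k) (fun K hHK hK => ?_)
      (fun K hHK hK => ?_) hX hXD
    · exact add_sum_le_ncard_mul_doubleCosetUnion hnot hdeg' hgrow (by omega) le_rfl hHK
        (htop ▸ le_top) (by rwa [htop, Subgroup.coe_top])
    · have := add_sum_le_ncard_mul_doubleCosetUnion (H := H) (s := s⁻¹) (k := k) (i := k) (K := K)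
        (by simpa only [towerGroup1_inv, Pi.inv_apply, inv_mem_iff] using hnot)
        (by simpa only [Pi.inv_apply, ncard_dcoset_inv] using hdeg')
        (by simpa only [towerGroup1_inv, Pi.inv_apply, ncard_dcoset_inv] using hgrow)
        (by omega) le_rfl hHK (by rw [towerGroup1_inv, htop]; exact le_top)
        (by rwa [towerGroup1_inv, htop, Subgroup.coe_top, doubleCosetUnion_inv])
      simpa only [doubleCosetUnion_inv, Pi.inv_apply, ncard_dcoset_inv] using this
  have hlow : ∀ A : Set (G ⧸ H),
      IsPart (cayleyRel H (((Finset.Icc 1 k).image s : Finset G) : Set G)) A →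
      ∑ i ∈ Finset.Icc 1 k, dval H (s i) ≤
        (Nout (cayleyRel H (((Finset.Icc 1 k).image s : Finset G) : Set G)) A).ncard := by
    rintro A ⟨hA, hAc⟩
    have h1 := hiso (QuotientGroup.mk ⁻¹' A) (hA.preimage QuotientGroup.mk_surjective) (by
      rw [← preimage_union_Nout]
      obtain ⟨y, hy⟩ := hAc
      obtain ⟨y, rfl⟩ := QuotientGroup.mk_surjective y
      exact fun h => hy (Set.mem_preimage.1 (h ▸ Set.mem_univ y)))
    rw [← preimage_union_Nout, ncard_preimage_mk, ncard_preimage_mk, hsum, ← mul_add] at h1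
    have h2 := Nat.le_of_mul_le_mul_left h1 hHpos
    have h3 := Set.ncard_union_le A
      (Nout (cayleyRel H (((Finset.Icc 1 k).image s : Finset G) : Set G)) A)
    omega
  have hdpos : ∀ i, 1 ≤ dval H (s i) := fun i =>
    (Set.ncard_pos (Set.toFinite _)).2 ⟨_, _, self_mem_dcoset H (s i), rfl⟩
  have hd2 : 2 ≤ ∑ i ∈ Finset.Icc 1 k, dval H (s i) := by
    have h := Finset.sum_le_sum (s := Finset.Icc 1 k) fun i _ => hdpos i
    simp only [Finset.sum_const, Nat.card_Icc, smul_eq_mul] at h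
    omega
  have hVcard : 2 * ∑ i ∈ Finset.Icc 1 k, dval H (s i) ≤ Nat.card (G ⧸ H) := by
    obtain ⟨i, rfl⟩ : ∃ i, k = i + 1 := ⟨k - 1, by omega⟩
    have h1 := hgrow i (by omega) (by omega)
    have h2 := two_mul_ncard_le_of_lt (M := towerGroup1 H s i) (L := ⊤)
      (lt_top_iff_ne_top.2 fun h => hnot i (by omega) (by omega) (h ▸ Subgroup.mem_top _))
    rw [Subgroup.coe_top, Set.ncard_univ,
      Subgroup.card_eq_card_quotient_mul_card_subgroup H] at h2
    rw [hsum] at h1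
    refine Nat.le_of_mul_le_mul_right ?_ hHpos
    linarith
  have hN := ncard_Nout_singleton_le (H := H) (s := s) (k := k) ((1 : G) : G ⧸ H)
  refine kappa_eq_of_isPart hlow (A := {((1 : G) : G ⧸ H)}) ⟨Set.singleton_nonempty _, ?_⟩ hN
  rw [Set.nonempty_compl]
  intro h
  have h1 := Set.ncard_union_le {((1 : G) : G ⧸ H)}
    (Nout (cayleyRel H (((Finset.Icc 1 k).image s : Finset G) : Set G)) {((1 : G) : G ⧸ H)})
  rw [h, Set.ncard_univ, Set.ncard_singleton] at h1
  omega
end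

section
/- Let G be a finite group with identity e, let S = {s₁,…,s_k} ⊆ G∖{e} with k ≥ 2 be such that the subgroups ⟨s₁,…,s_i⟩, 1 ≤ i ≤ k, are pairwise distinct and ⟨S⟩ = G (so Cay(G,S) is hierarchical and connected), and let S' ⊆ S⁻¹ = {s⁻¹ : s ∈ S} be a set all of whose elements have order at least three. If |⟨s₁,s₂⟩| ≠ 4, then κ(Cay(G, S ∪ S')) = |S ∪ S'|. -/
open Classical

/-- Edge relation of the Cayley digraph `Cay(G,S)`: an edge from `g₁` to `g₂` iff
`g₁⁻¹g₂ ∈ S`. -/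
def cayRel {G : Type*} [Group G] (S : Set G) : G → G → Prop :=
  fun x y => x⁻¹ * y ∈ S

/-- The subgroup generated by `s 1, …, s (l - 1)`. -/
def flag {G : Type*} [Group G] (s : ℕ → G) (l : ℕ) : Subgroup G :=
  Subgroup.closure (s '' Set.Ico 1 l)

section Boundary

variable {G : Type*} [Group G]

lemma ncard_union_Nout {V : Type*} [Finite V] (E : V → V → Prop) (A : Set V) :
    (A ∪ Nout E A).ncard = A.ncard + (Nout E A).ncard :=
  Set.ncard_union_eq (Set.disjoint_left.2 fun _ ha hn => hn.1 ha)

/-- Submodularity of the size of the out-neighborhood. -/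
lemma ncard_Nout_inter_add_union_le {V : Type*} [Finite V] (E : V → V → Prop) (A B : Set V) :
    (Nout E (A ∩ B)).ncard + (Nout E (A ∪ B)).ncard ≤ (Nout E A).ncard + (Nout E B).ncard := by
  have h1 : (A ∩ B ∪ Nout E (A ∩ B)).ncard ≤ ((A ∪ Nout E A) ∩ (B ∪ Nout E B)).ncard := by
    refine Set.ncard_le_ncard ?_
    rintro x (⟨ha, hb⟩ | ⟨-, y, ⟨ha, hb⟩, hy⟩)
    · exact ⟨Or.inl ha, Or.inl hb⟩
    · refine ⟨?_, ?_⟩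
      · by_cases h : x ∈ A
        · exact Or.inl h
        · exact Or.inr ⟨h, y, ha, hy⟩
      · by_cases h : x ∈ B
        · exact Or.inl h
        · exact Or.inr ⟨h, y, hb, hy⟩
  have h2 : (A ∪ B ∪ Nout E (A ∪ B)).ncard ≤ ((A ∪ Nout E A) ∪ (B ∪ Nout E B)).ncard := by
    refine Set.ncard_le_ncard ?_
    rintro x ((ha | hb) | ⟨hx, y, (ha | hb), hy⟩)
    · exact Or.inl (Or.inl ha)
    · exact Or.inr (Or.inl hb)
    · exact Or.inl (Or.inr ⟨fun h => hx (Or.inl h), y, ha, hy⟩)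
    · exact Or.inr (Or.inr ⟨fun h => hx (Or.inr h), y, hb, hy⟩)
  have h3 := Set.ncard_union_add_ncard_inter (A ∪ Nout E A) (B ∪ Nout E B)
  have h4 := Set.ncard_union_add_ncard_inter A B
  have := ncard_union_Nout E A
  have := ncard_union_Nout E B
  have := ncard_union_Nout E (A ∩ B)
  have := ncard_union_Nout E (A ∪ B)
  omega

lemma Nout_smul (T : Set G) (g : G) (A : Set G) :
    Nout (cayRel T) ((g * ·) '' A) = (g * ·) '' Nout (cayRel T) A := by
  ext x
  constructor
  · rintro ⟨hx, _, ⟨y, hy, rfl⟩, hT⟩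
    refine ⟨g⁻¹ * x, ⟨fun h => hx ⟨_, h, by simp⟩, y, hy, ?_⟩, by simp⟩
    simpa [cayRel, mul_assoc] using hT
  · rintro ⟨x, ⟨hx, y, hy, hT⟩, rfl⟩
    refine ⟨?_, g * y, ⟨y, hy, rfl⟩, ?_⟩
    · rintro ⟨z, hz, hzx⟩
      exact hx (mul_left_cancel hzx ▸ hz)
    · simpa [cayRel, mul_assoc] using hT

lemma IsPart.smul {T A : Set G} (hA : IsPart (cayRel T) A) (g : G) :
    IsPart (cayRel T) ((g * ·) '' A) := by
  obtain ⟨hne, z, hz⟩ := hA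
  refine ⟨hne.image _, g * z, ?_⟩
  rw [Nout_smul, ← Set.image_union]
  rintro ⟨w, hw, hwz⟩
  exact hz (mul_left_cancel hwz ▸ hw)

lemma ncard_mul_left_image (g : G) (A : Set G) : ((g * ·) '' A).ncard = A.ncard :=
  Set.ncard_image_of_injective _ (mul_right_injective g)

/-- The complement of the closure of a part is a part of the reversed digraph. -/
lemma IsPart.compl_inv {T A : Set G} (hA : IsPart (cayRel T) A) :
    IsPart (cayRel T⁻¹) (A ∪ Nout (cayRel T) A)ᶜ ∧
      Nout (cayRel T⁻¹) (A ∪ Nout (cayRel T) A)ᶜ ⊆ Nout (cayRel T) A := by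
  have key : Nout (cayRel T⁻¹) (A ∪ Nout (cayRel T) A)ᶜ ⊆ Nout (cayRel T) A := by
    rintro x ⟨hx, y, hy, hT⟩
    rw [Set.notMem_compl_iff] at hx
    rcases hx with hx | hx
    · refine absurd (Or.inr ⟨fun h => hy (Or.inl h), x, hx, ?_⟩) hy
      simpa [cayRel] using hT
    · exact hx
  refine ⟨⟨hA.2, ?_⟩, key⟩
  obtain ⟨a, ha⟩ := hA.1
  refine ⟨a, ?_⟩
  rintro (h | h)
  · exact h (Or.inl ha)
  · exact (key h).1 ha

variable [Finite G]

/-- A fragment that is no larger than any fragment of the digraph or of its reverse is a left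
coset of a subgroup. -/
lemma exists_subgroup_of_minimal {T A : Set G} (hA : IsPart (cayRel T) A)
    (hκ : ∀ B, IsPart (cayRel T) B → (Nout (cayRel T) A).ncard ≤ (Nout (cayRel T) B).ncard)
    (hpos : ∀ B, IsPart (cayRel T) B →
      (Nout (cayRel T) B).ncard = (Nout (cayRel T) A).ncard → A.ncard ≤ B.ncard)
    (hneg : ∀ B, IsPart (cayRel T⁻¹) B →
      (Nout (cayRel T⁻¹) B).ncard ≤ (Nout (cayRel T) A).ncard → A.ncard ≤ B.ncard) :
    ∃ H : Subgroup G, IsPart (cayRel T) (H : Set G) ∧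
      (Nout (cayRel T) (H : Set G)).ncard = (Nout (cayRel T) A).ncard := by
  have hsize : 2 * A.ncard + (Nout (cayRel T) A).ncard ≤ Nat.card G := by
    have h1 := hneg _ hA.compl_inv.1 (Set.ncard_le_ncard hA.compl_inv.2)
    have h2 := Set.ncard_add_ncard_compl (A ∪ Nout (cayRel T) A)
    have h3 := ncard_union_Nout (cayRel T) A
    omega
  have hblock : ∀ g : G, (A ∩ (g * ·) '' A).Nonempty → (g * ·) '' A = A := by
    intro g hg
    by_contra hne
    set B := (g * ·) '' A with hB
    have hBcard : B.ncard = A.ncard := ncard_mul_left_image g A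
    have hNB : (Nout (cayRel T) B).ncard = (Nout (cayRel T) A).ncard := by
      rw [hB, Nout_smul, ncard_mul_left_image]
    have hlt : (A ∩ B).ncard < A.ncard := by
      refine Set.ncard_lt_ncard (Set.inter_subset_left.ssubset_of_ne fun h => hne ?_)
      have hsub : A ⊆ B := Set.inter_eq_left.1 h
      exact (Set.eq_of_subset_of_ncard_le hsub hBcard.le).symm
    have hpart : IsPart (cayRel T) (A ∩ B) := by
      refine ⟨hg, hA.2.mono (Set.compl_subset_compl.2 ?_)⟩
      rintro x (hx | ⟨-, y, hy, hT⟩)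
      · exact Or.inl hx.1
      · by_cases h : x ∈ A
        · exact Or.inl h
        · exact Or.inr ⟨h, y, hy.1, hT⟩
    have hsub := ncard_Nout_inter_add_union_le (cayRel T) A B
    have h1 := hκ _ hpart
    have hunion : IsPart (cayRel T) (A ∪ B) := by
      refine ⟨hA.1.mono Set.subset_union_left, ?_⟩
      rw [Set.nonempty_compl]
      intro h
      have h2 := ncard_union_Nout (cayRel T) (A ∪ B)
      rw [h, Set.ncard_univ] at h2
      have h3 := Set.ncard_union_add_ncard_inter A B
      have h4 : 0 < (A ∩ B).ncard := (Set.ncard_pos).2 hg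
      omega
    have h2 := hκ _ hunion
    have h3 := hpos _ hpart (by omega)
    omega
  obtain ⟨a, ha⟩ := hA.1
  have hmove : ∀ g, a * g ∈ A → ((a * g * a⁻¹) * ·) '' A = A := fun g hg =>
    hblock _ ⟨a * g, hg, a, ha, by simp⟩
  let H : Subgroup G :=
    { carrier := {g | a * g ∈ A}
      one_mem' := by simpa using ha
      mul_mem' := by
        intro g h hg hh
        have : a * g * a⁻¹ * (a * h) ∈ A := (hmove g hg).subset ⟨_, hh, rfl⟩
        simpa [mul_assoc] using this
      inv_mem' := by
        intro g hg
        obtain ⟨y, hy, hya⟩ := (hmove g hg).superset ha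
        have : y = a * g⁻¹ := by
          have : a * g * a⁻¹ * y = a := hya
          rw [← eq_inv_mul_iff_mul_eq] at this
          simpa [mul_assoc] using this
        exact show a * g⁻¹ ∈ A from this ▸ hy }
  have hH : (H : Set G) = (a⁻¹ * ·) '' A := by
    ext g
    exact ⟨fun hg => ⟨a * g, hg, by simp⟩, by rintro ⟨y, hy, rfl⟩; simpa [H] using hy⟩
  refine ⟨H, hH ▸ hA.smul a⁻¹, ?_⟩
  rw [hH, Nout_smul, ncard_mul_left_image]

/-- If some part has a boundary smaller than `c`, then so does a subgroup, possibly in the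
reversed digraph. -/
lemma exists_subgroup_ncard_Nout_lt {T A : Set G} {c : ℕ} (hA : IsPart (cayRel T) A)
    (hc : (Nout (cayRel T) A).ncard < c) :
    ∃ H : Subgroup G,
      (IsPart (cayRel T) (H : Set G) ∧ (Nout (cayRel T) (H : Set G)).ncard < c) ∨
      (IsPart (cayRel T⁻¹) (H : Set G) ∧ (Nout (cayRel T⁻¹) (H : Set G)).ncard < c) := by
  have hflip : ∀ (U B : Set G), IsPart (cayRel U) B → ∃ C, IsPart (cayRel U⁻¹) C ∧
      (Nout (cayRel U⁻¹) C).ncard ≤ (Nout (cayRel U) B).ncard := fun U B hB =>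
    ⟨_, hB.compl_inv.1, Set.ncard_le_ncard hB.compl_inv.2⟩
  have hex : ∃ n, ∃ B, IsPart (cayRel T) B ∧ (Nout (cayRel T) B).ncard = n := ⟨_, A, hA, rfl⟩
  have hκmin : ∀ B, IsPart (cayRel T) B → Nat.find hex ≤ (Nout (cayRel T) B).ncard :=
    fun B hB => Nat.find_min' hex ⟨B, hB, rfl⟩
  obtain ⟨A₀, hA₀, hA₀κ⟩ := Nat.find_spec hex
  set κ := Nat.find hex
  have hκmin' : ∀ B, IsPart (cayRel T⁻¹) B → κ ≤ (Nout (cayRel T⁻¹) B).ncard := by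
    intro B hB
    obtain ⟨C, hC, hCB⟩ := hflip _ B hB
    rw [inv_inv] at hC hCB
    exact (hκmin C hC).trans hCB
  have hκc : κ < c := (hκmin A hA).trans_lt hc
  have hex' : ∃ n, ∃ U B, (U = T ∨ U = T⁻¹) ∧ IsPart (cayRel U) B ∧
      (Nout (cayRel U) B).ncard = κ ∧ B.ncard = n := ⟨_, T, A₀, Or.inl rfl, hA₀, hA₀κ, rfl⟩
  obtain ⟨U, B, hU, hB, hBκ, hBn⟩ := Nat.find_spec hex'
  have hmin : ∀ U' C, (U' = T ∨ U' = T⁻¹) → IsPart (cayRel U') C →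
      (Nout (cayRel U') C).ncard = κ → B.ncard ≤ C.ncard := fun U' C hU' hC hCκ =>
    hBn ▸ Nat.find_min' hex' ⟨U', C, hU', hC, hCκ, rfl⟩
  have hκU : ∀ U', (U' = T ∨ U' = T⁻¹) → ∀ C, IsPart (cayRel U') C →
      κ ≤ (Nout (cayRel U') C).ncard := by
    rintro _ (rfl | rfl)
    exacts [hκmin, hκmin']
  have hU' : U⁻¹ = T ∨ U⁻¹ = T⁻¹ := by
    rcases hU with rfl | rfl <;> simp
  obtain ⟨H, hH, hHκ⟩ := exists_subgroup_of_minimal hB (fun C hC => hBκ ▸ hκU U hU C hC)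
    (fun C hC h => hmin U C hU hC (h.trans hBκ))
    (fun C hC h => hmin U⁻¹ C hU' hC (le_antisymm (h.trans_eq hBκ) (hκU _ hU' C hC)))
  refine ⟨H, ?_⟩
  rcases hU with rfl | rfl
  · exact Or.inl ⟨hH, by omega⟩
  · exact Or.inr ⟨hH, by omega⟩

/-- A Cayley digraph in which every part has boundary at least `|T|` is optimally connected. -/
lemma kappa_cayRel_eq {T : Set G} (h1 : (1 : G) ∉ T)
    (h : ∀ A, IsPart (cayRel T) A → T.ncard ≤ (Nout (cayRel T) A).ncard) :
    kappa (cayRel T) = T.ncard := by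
  have hlow : ∀ X : Set G, ¬ SCOn (cayRel T) Xᶜ → T.ncard ≤ X.ncard := by
    intro X hX
    simp only [SCOn, not_forall] at hX
    obtain ⟨a, ha, b, hb, hab⟩ := hX
    set R := fun x y => x ∈ Xᶜ ∧ y ∈ Xᶜ ∧ cayRel T x y
    set A : Set G := {x | Relation.ReflTransGen R a x} with hAdef
    have hAX : A ⊆ Xᶜ := by
      intro x hx
      rcases Relation.ReflTransGen.cases_tail hx with rfl | ⟨c, -, hc⟩
      exacts [ha, hc.2.1]
    have hN : Nout (cayRel T) A ⊆ X := by
      rintro x ⟨hx, y, hy, hyx⟩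
      by_contra hxX
      exact hx (Relation.ReflTransGen.tail hy ⟨hAX hy, hxX, hyx⟩)
    refine (h A ⟨⟨a, Relation.ReflTransGen.refl⟩, b, ?_⟩).trans (Set.ncard_le_ncard hN)
    rintro (hbA | hbN)
    exacts [hab hbA, hb (hN hbN)]
  unfold kappa
  split_ifs with hX
  · apply le_antisymm
    · by_cases hT : ∃ g : G, g ≠ 1 ∧ g ∉ T
      · obtain ⟨g, hg1, hgT⟩ := hT
        refine Nat.sInf_le ⟨T, rfl, fun hSC => ?_⟩
        rcases Relation.ReflTransGen.cases_head (hSC 1 h1 g hgT) with h | ⟨c, ⟨-, hc, hE⟩, -⟩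
        · exact hg1 h.symm
        · exact hc (by simpa [cayRel] using hE)
      · push Not at hT
        obtain ⟨X, hX⟩ := hX
        refine absurd (fun a ha b hb => ?_) hX
        by_cases hab : a = b
        · exact hab ▸ Relation.ReflTransGen.refl
        · refine Relation.ReflTransGen.single ⟨ha, hb, hT _ ?_⟩
          rwa [Ne, inv_mul_eq_one]
    · obtain ⟨X, hX⟩ := hX
      obtain ⟨Y, hY, hYX⟩ := Nat.sInf_mem (s := {m | ∃ T' : Set G, T'.ncard = m ∧
        ¬ SCOn (cayRel T) T'ᶜ}) ⟨_, X, rfl, hX⟩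
      exact (hlow Y hYX).trans_eq hY
  · push Not at hX
    have hT : T = {1}ᶜ := by
      ext g
      refine ⟨fun hg h => h1 (h ▸ hg), fun hg => ?_⟩
      by_contra hgT
      rcases Relation.ReflTransGen.cases_head (hX T 1 h1 g hgT) with h | ⟨c, ⟨-, hc, hE⟩, -⟩
      · exact hg h.symm
      · exact hc (by simpa [cayRel] using hE)
    have := Set.ncard_add_ncard_compl ({1} : Set G)
    rw [Set.ncard_singleton] at this
    rw [hT]
    omega

end Boundary

section Flag

variable {G : Type*} [Group G] {s : ℕ → G}

lemma flag_mono : Monotone (flag s) := fun _ _ h =>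
  Subgroup.closure_mono (Set.image_mono (Set.Ico_subset_Ico_right h))

lemma mem_flag {i l : ℕ} (hi : 1 ≤ i) (hil : i < l) : s i ∈ flag s l :=
  Subgroup.subset_closure ⟨i, ⟨hi, hil⟩, rfl⟩

lemma flag_le {l : ℕ} {H : Subgroup G} (h : ∀ i, 1 ≤ i → i < l → s i ∈ H) : flag s l ≤ H := by
  rw [flag, Subgroup.closure_le]
  rintro _ ⟨i, ⟨h1, h2⟩, rfl⟩
  exact h i h1 h2

lemma flag_one : flag s 1 = ⊥ := by simp [flag]

lemma ncard_setOf_mul_inv_mem (H : Subgroup G) (t : G) :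
    {g : G | g * t⁻¹ ∈ H}.ncard = Nat.card H := by
  have : {g : G | g * t⁻¹ ∈ H} = (· * t) '' (H : Set G) := by
    ext g
    exact ⟨fun h => ⟨g * t⁻¹, h, by simp⟩, by rintro ⟨x, hx, rfl⟩; simpa using hx⟩
  rw [this, Set.ncard_image_of_injective _ (mul_left_injective t)]
  rfl

lemma setOf_mul_inv_mem_subset_Nout {T : Set G} {H : Subgroup G} {t : G} (ht : t ∈ T)
    (htH : t ∉ H) : {g : G | g * t⁻¹ ∈ H} ⊆ Nout (cayRel T) (H : Set G) := by
  intro g hg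
  refine ⟨fun hgH => htH ?_, g * t⁻¹, hg, by simpa [cayRel] using ht⟩
  have := H.mul_mem (H.inv_mem hg) hgH
  simpa using this

variable [Finite G]

lemma two_mul_card_le_card {H K : Subgroup G} (hle : H ≤ K) {g : G} (hK : g ∈ K) (hH : g ∉ H) :
    2 * Nat.card H ≤ Nat.card K := by
  obtain ⟨m, hm⟩ := Subgroup.card_dvd_of_le hle
  have hKpos : 0 < Nat.card K := Nat.card_pos
  rcases m with _ | _ | m
  · omega
  · exact absurd (Subgroup.eq_of_le_of_card_ge hle (by omega) ▸ hK) hH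
  · rw [hm]
    nlinarith [Nat.zero_le (Nat.card H * m)]

lemma three_le_card {K : Subgroup G} {x y : G} (hx : x ∈ K) (hy : y ∈ K) (hx1 : x ≠ 1)
    (hy1 : y ≠ 1) (hxy : x ≠ y) : 3 ≤ Nat.card K := by
  have h : ({1, x, y} : Set G).ncard ≤ (K : Set G).ncard := by
    refine Set.ncard_le_ncard ?_
    rintro z (rfl | rfl | rfl)
    exacts [K.one_mem, hx, hy]
  rwa [Set.ncard_eq_three.2 ⟨1, x, y, hx1.symm, hy1.symm, hxy, rfl⟩] at h

lemma le_of_card_eq_four {H K : Subgroup G} (hle : K ≤ H) (hH : Nat.card H = 4)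
    (hK : 3 ≤ Nat.card K) : H ≤ K := by
  intro g hg
  by_contra hgK
  have := two_mul_card_le_card hle hg hgK
  omega

/-- Each index at which the trace of the flag on `H` grows doubles the cardinality. -/
lemma card_inf_flag_mul_two_pow_le (H : Subgroup G) (F : Finset ℕ) (m : ℕ)
    (hF : ∀ l ∈ F, m ≤ l ∧ ∃ g ∈ H, g ∈ flag s (l + 1) ∧ g ∉ flag s l) :
    Nat.card (H ⊓ flag s m : Subgroup G) * 2 ^ F.card ≤ Nat.card H := by
  suffices h : ∀ n, m ≤ n → (∀ l ∈ F, l < n) →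
      Nat.card (H ⊓ flag s m : Subgroup G) * 2 ^ F.card ≤
        Nat.card (H ⊓ flag s n : Subgroup G) by
    refine (h (m + F.sup id + 1) (by omega) fun l hl => ?_).trans
      (Subgroup.card_le_of_le inf_le_left)
    have : l ≤ F.sup id := Finset.le_sup (f := id) hl
    omega
  induction F using Finset.induction_on_max with
  | empty =>
    intro n hn _
    simpa using Subgroup.card_le_of_le (inf_le_inf_left H (flag_mono (s := s) hn))
  | insert a F ha ih =>
    intro n hn hlt
    obtain ⟨hma, g, hgH, hg, hg'⟩ := hF a (Finset.mem_insert_self _ _)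
    have h1 := ih (fun l hl => hF l (Finset.mem_insert_of_mem hl)) a hma ha
    have h2 : 2 * Nat.card (H ⊓ flag s a : Subgroup G) ≤
        Nat.card (H ⊓ flag s n : Subgroup G) := by
      have han : a + 1 ≤ n := hlt a (Finset.mem_insert_self _ _)
      exact two_mul_card_le_card (inf_le_inf_left H (flag_mono (by omega)))
        ⟨hgH, flag_mono han hg⟩ fun h => hg' h.2
    rw [Finset.card_insert_of_notMem fun h => lt_irrefl _ (ha a h), pow_succ]
    linarith

lemma ncard_le_two_mul_card {X : Set G} {F : Finset ℕ}
    (h : ∀ x ∈ X, ∃ l ∈ F, x = s l ∨ x = (s l)⁻¹) : X.ncard ≤ 2 * F.card := by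
  have h1 : X.ncard ≤ ((F.image s ∪ F.image fun l => (s l)⁻¹ : Finset G) : Set G).ncard := by
    refine Set.ncard_le_ncard (fun x hx => ?_)
    obtain ⟨l, hl, rfl | rfl⟩ := h x hx
    · exact Finset.mem_coe.2 (Finset.mem_union_left _ (Finset.mem_image_of_mem _ hl))
    · exact Finset.mem_coe.2 (Finset.mem_union_right _ (Finset.mem_image.2 ⟨l, hl, rfl⟩))
  rw [Set.ncard_coe_finset] at h1
  have h2 := Finset.card_union_le (F.image s) (F.image fun l => (s l)⁻¹)
  have h3 := Finset.card_image_le (s := F) (f := s)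
  have h4 := Finset.card_image_le (s := F) (f := fun l => (s l)⁻¹)
  omega

end Flag

/-- `T` consists of a hierarchical generating sequence `s 1, …, s k`, together with some inverses
of its members that are not involutions, and `s 1`, `s 2` do not generate a group of order four. -/
structure IsHierarchicalSet {G : Type*} [Group G] (s : ℕ → G) (k : ℕ) (T : Set G) : Prop where
  notMem_flag : ∀ l, 1 ≤ l → l ≤ k → s l ∉ flag s l
  flag_eq_top : flag s (k + 1) = ⊤
  mem : ∀ l, 1 ≤ l → l ≤ k → s l ∈ T
  eq_or_eq_inv : ∀ t ∈ T, ∃ l, 1 ≤ l ∧ l ≤ k ∧ (t = s l ∨ t = (s l)⁻¹ ∧ s l * s l ≠ 1)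
  two_le : 2 ≤ k
  card_flag_ne : Nat.card (flag s 3) ≠ 4

namespace IsHierarchicalSet

variable {G : Type*} [Group G] {s : ℕ → G} {k : ℕ} {T : Set G}

lemma one_notMem (hT : IsHierarchicalSet s k T) : (1 : G) ∉ T := by
  intro h
  obtain ⟨l, h1, hk, h | ⟨h, -⟩⟩ := hT.eq_or_eq_inv 1 h
  · exact hT.notMem_flag l h1 hk (h ▸ one_mem _)
  · exact hT.notMem_flag l h1 hk (by rw [← inv_inv (s l), ← h, inv_one]; exact one_mem _)

lemma inv (hT : IsHierarchicalSet s k T) : IsHierarchicalSet (fun l => (s l)⁻¹) k T⁻¹ := by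
  have hflag : ∀ l, flag (fun l => (s l)⁻¹) l = flag s l := by
    intro l
    rw [flag, flag, ← Subgroup.closure_inv (s '' _)]
    congr 1
    ext x
    simp [inv_eq_iff_eq_inv]
  refine ⟨?_, by rw [hflag]; exact hT.flag_eq_top, ?_, ?_, hT.two_le,
    by rw [hflag]; exact hT.card_flag_ne⟩
  · intro l h1 hk
    rw [hflag, inv_mem_iff]
    exact hT.notMem_flag l h1 hk
  · intro l h1 hk
    simpa using hT.mem l h1 hk
  · intro t ht
    obtain ⟨l, h1, hk, h | ⟨h, h2⟩⟩ := hT.eq_or_eq_inv _ ht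
    · exact ⟨l, h1, hk, Or.inl (by rw [← h, inv_inv])⟩
    · refine ⟨l, h1, hk, Or.inr ⟨by rw [← h, inv_inv], ?_⟩⟩
      rwa [← mul_inv_rev, Ne, inv_eq_one]

/-- If `H` lies below the `r`-th step of the flag, then the coset `H * s r` meets `T` only in
`s r` and its inverse. -/
lemma inter_coset_subset (hT : IsHierarchicalSet s k T) {H : Subgroup G} {r : ℕ} (h1 : 1 ≤ r)
    (hk : r ≤ k) (hH : H ≤ flag s r) :
    T ∩ {g | g * (s r)⁻¹ ∈ H} ⊆ {s r, (s r)⁻¹} := by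
  rintro t ⟨htT, ht⟩
  obtain ⟨l, hl1, hlk, hl⟩ := hT.eq_or_eq_inv t htT
  have ht' : ∀ K : Subgroup G, t ∈ K ↔ s l ∈ K := by
    intro K
    rcases hl with rfl | ⟨rfl, -⟩ <;> simp
  rcases lt_trichotomy l r with h | rfl | h
  · have htr : t ∈ flag s r := (ht' _).2 (mem_flag hl1 h)
    have := mul_mem (inv_mem (hH ht)) htr
    exact absurd (by simpa using this) (hT.notMem_flag r h1 hk)
  · rcases hl with rfl | ⟨rfl, -⟩ <;> simp
  · have := mul_mem (flag_mono h.le (hH ht)) (mem_flag (s := s) h1 h)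
    rw [inv_mul_cancel_right] at this
    exact absurd ((ht' _).1 this) (hT.notMem_flag l hl1 hlk)

variable [Finite G]

lemma ncard_inter_lt (hT : IsHierarchicalSet s k T) (H : Subgroup G) :
    (T ∩ H).ncard < Nat.card H := by
  have : (T ∩ H) ⊂ (H : Set G) :=
    ⟨Set.inter_subset_right, fun h => hT.one_notMem (h H.one_mem).1⟩
  exact Set.ncard_lt_ncard this

lemma three_le_card_flag_two (hT : IsHierarchicalSet s k T) (h1 : s 2 * s 2 ∈ flag s 2)
    (h2 : s 2 * s 2 ≠ 1) : 3 ≤ Nat.card (flag s 2) := by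
  have hk := hT.two_le
  have hs1 : s 1 ∈ flag s 2 := mem_flag le_rfl (by omega)
  have hs1' : s 1 ≠ 1 := fun h => hT.notMem_flag 1 le_rfl (by omega) (h ▸ one_mem _)
  by_cases h : s 1 = s 2 * s 2
  · by_cases h' : s 1 * s 1 = 1
    · exfalso
      have hord : orderOf (s 2) = 2 ^ (1 + 1) := by
        refine orderOf_eq_prime_pow (by simpa [pow_two] using h2) ?_
        rw [h] at h'
        simpa [pow_succ, mul_assoc] using h'
      have hfl : flag s 3 = Subgroup.zpowers (s 2) := by
        apply le_antisymm
        · refine flag_le fun i hi hi3 => ?_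
          interval_cases i
          · rw [h]
            exact mul_mem (Subgroup.mem_zpowers _) (Subgroup.mem_zpowers _)
          · exact Subgroup.mem_zpowers _
        · rw [Subgroup.zpowers_le]
          exact mem_flag (by omega) (by omega)
      apply hT.card_flag_ne
      rw [hfl, Nat.card_zpowers, hord]
      rfl
    · refine three_le_card hs1 (inv_mem hs1) hs1' (by simpa using hs1') fun h'' => h' ?_
      rw [eq_inv_iff_mul_eq_one] at h''
      exact h''
  · exact three_le_card hs1 h1 hs1' h2 h

lemma six_le_card_flag_three (hT : IsHierarchicalSet s k T) : 6 ≤ Nat.card (flag s 3) := by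
  have hk := hT.two_le
  have h1 : 2 * Nat.card (flag s 1) ≤ Nat.card (flag s 2) :=
    two_mul_card_le_card (flag_mono (by omega)) (mem_flag le_rfl (by omega))
      (hT.notMem_flag 1 le_rfl (by omega))
  have h2 : 2 * Nat.card (flag s 2) ≤ Nat.card (flag s 3) :=
    two_mul_card_le_card (flag_mono (by omega)) (mem_flag (by omega) (by omega))
      (hT.notMem_flag 2 (by omega) (by omega))
  have h0 : 0 < Nat.card (flag s 1) := Nat.card_pos
  obtain ⟨m, hm⟩ := Subgroup.card_dvd_of_le (flag_mono (s := s) (show 2 ≤ 3 by omega))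
  have h4 := hT.card_flag_ne
  by_cases ha : Nat.card (flag s 2) = 2
  · rw [ha] at hm
    omega
  · omega

lemma ncard_le_of_ncard_inter_le (H : Subgroup G)
    (h : (T ∩ H).ncard ≤ (Nout (cayRel T) (H : Set G) \ T).ncard) :
    T.ncard ≤ (Nout (cayRel T) (H : Set G)).ncard := by
  have h1 := Set.ncard_inter_add_ncard_sdiff_eq_ncard T (H : Set G)
  have h2 := Set.ncard_inter_add_ncard_sdiff_eq_ncard (Nout (cayRel T) (H : Set G)) T
  have h3 : (T \ H).ncard ≤ (Nout (cayRel T) (H : Set G) ∩ T).ncard :=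
    Set.ncard_le_ncard fun t ht => ⟨⟨ht.2, 1, H.one_mem, by simpa [cayRel] using ht.1⟩, ht.1⟩
  omega

/-- If `H` has order four and contains a non-involution of the sequence, then a coset `H * s j`
can contain both `s l` and its inverse, for some `l > j`, only if `s l` is an involution. -/
lemma mul_self_eq_one_of_card_eq_four (hT : IsHierarchicalSet s k T) {H : Subgroup G} {i j l : ℕ}
    (hj1 : 1 ≤ j) (hjl : j < l) (hlk : l ≤ k) (hi1 : 1 ≤ i) (hik : i ≤ k) (hil : i ≠ l)
    (hH : Nat.card H = 4) (hi : s i ∈ H) (hi2 : s i * s i ≠ 1)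
    (hl : s l * (s j)⁻¹ ∈ H) (hl' : (s l)⁻¹ * (s j)⁻¹ ∈ H) : s l * s l = 1 := by
  by_contra hl2
  have hlfl := hT.notMem_flag l (by omega) hlk
  have hifl := hT.notMem_flag i hi1 hik
  have hjfl : s j ∈ flag s l := mem_flag hj1 hjl
  have hjfl' := inv_mem (flag_mono (s := s) l.le_succ hjfl)
  have hll : s l ∈ flag s (l + 1) := mem_flag (by omega) (by omega)
  have hii : s i ∈ flag s (i + 1) := mem_flag hi1 (by omega)
  have h1 : H ≤ H ⊓ flag s (l + 1) := by
    refine le_of_card_eq_four inf_le_left hH (three_le_card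
      ⟨hl, mul_mem hll hjfl'⟩ ⟨hl', mul_mem ((flag s (l + 1)).inv_mem hll) hjfl'⟩ ?_ ?_ ?_)
    · rw [Ne, mul_inv_eq_one]
      exact fun h => hlfl (h ▸ hjfl)
    · rw [Ne, mul_inv_eq_one, inv_eq_iff_eq_inv]
      exact fun h => hlfl (h ▸ inv_mem hjfl)
    · intro h
      rw [mul_left_inj, eq_inv_iff_mul_eq_one] at h
      exact hl2 h
  have h2 : H ≤ H ⊓ flag s (i + 1) := by
    refine le_of_card_eq_four inf_le_left hH (three_le_card
      ⟨hi, hii⟩ ⟨H.inv_mem hi, (flag s (i + 1)).inv_mem hii⟩ ?_ ?_ ?_)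
    · exact fun h => hifl (h ▸ one_mem _)
    · exact fun h => hifl (inv_eq_one.1 h ▸ one_mem _)
    · rw [Ne, eq_inv_iff_mul_eq_one]
      exact hi2
  have h3 : i < l := by
    by_contra h
    exact hifl (flag_mono (by omega) (h1 hi).2)
  have h4 := mul_mem (flag_mono (s := s) h3 (h2 hl).2) hjfl
  exact hlfl (by simpa using h4)

/-- If `s j` is the first member of the sequence outside `H`, then `T` misses at least `|T ∩ H|`
elements of the coset `H * s j`, apart from one exceptional configuration. -/
lemma ncard_inter_add_ncard_inter_le (hT : IsHierarchicalSet s k T) {H : Subgroup G} {j : ℕ}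
    (hj1 : 1 ≤ j) (hjk : j ≤ k) (hjH : s j ∉ H) (hmin : ∀ i, 1 ≤ i → i < j → s i ∈ H) :
    (T ∩ H).ncard + (T ∩ {g | g * (s j)⁻¹ ∈ H}).ncard ≤ Nat.card H ∨
      (Nat.card H = 3 ∧ j = 2 ∧ s 2 * s 2 ∈ flag s 2 ∧ s 2 * s 2 ≠ 1) := by
  set C : Set G := {g | g * (s j)⁻¹ ∈ H} with hC
  set I := (Finset.Icc 1 k).filter fun l => s l ∈ H with hI
  set J := (Finset.Icc 1 k).filter fun l => s l * (s j)⁻¹ ∈ H ∨ (s l)⁻¹ * (s j)⁻¹ ∈ H with hJ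
  have memI : ∀ {l}, l ∈ I ↔ (1 ≤ l ∧ l ≤ k) ∧ s l ∈ H := by
    intro l; rw [hI, Finset.mem_filter, Finset.mem_Icc]
  have memJ : ∀ {l}, l ∈ J ↔ (1 ≤ l ∧ l ≤ k) ∧
      (s l * (s j)⁻¹ ∈ H ∨ (s l)⁻¹ * (s j)⁻¹ ∈ H) := by
    intro l; rw [hJ, Finset.mem_filter, Finset.mem_Icc]
  have hjJ : j ∈ J := memJ.2 ⟨⟨hj1, hjk⟩, Or.inl (by simp)⟩
  have hIJ : Disjoint I J := by
    rw [Finset.disjoint_left]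
    intro l hlI hlJ
    have hl := (memI.1 hlI).2
    rcases (memJ.1 hlJ).2 with h | h
    · exact hjH (inv_mem_iff.1 ((Subgroup.mul_mem_cancel_left H hl).1 h))
    · exact hjH (inv_mem_iff.1 ((Subgroup.mul_mem_cancel_left H (inv_mem hl)).1 h))
  have hJlt : ∀ l ∈ J.erase j, j < l := by
    intro l hl
    obtain ⟨hlj, hlJ⟩ := Finset.mem_erase.1 hl
    by_contra h
    have hl1 := (memJ.1 hlJ).1
    exact Finset.disjoint_left.1 hIJ (memI.2 ⟨hl1, hmin l hl1.1 (by omega)⟩) hlJ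
  have hgrowI : ∀ l ∈ I, ∃ g ∈ H, g ∈ flag s (l + 1) ∧ g ∉ flag s l := fun l hl =>
    ⟨s l, (memI.1 hl).2, mem_flag (memI.1 hl).1.1 (by omega),
      hT.notMem_flag l (memI.1 hl).1.1 (memI.1 hl).1.2⟩
  have hgrowJ : ∀ l ∈ J.erase j, ∃ g ∈ H, g ∈ flag s (l + 1) ∧ g ∉ flag s l := by
    intro l hl
    have hjl := hJlt l hl
    obtain ⟨⟨hl1, hlk⟩, hlJ⟩ := memJ.1 (Finset.mem_of_mem_erase hl)
    have hjfl : s j ∈ flag s l := mem_flag hj1 hjl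
    have hjfl' := inv_mem (flag_mono (s := s) l.le_succ hjfl)
    have hlfl := hT.notMem_flag l hl1 hlk
    have hll : s l ∈ flag s (l + 1) := mem_flag hl1 (by omega)
    rcases hlJ with h | h
    · exact ⟨_, h, mul_mem hll hjfl', by
        rwa [Subgroup.mul_mem_cancel_right _ (inv_mem hjfl)]⟩
    · exact ⟨_, h, mul_mem (inv_mem hll) hjfl', by
        rwa [Subgroup.mul_mem_cancel_right _ (inv_mem hjfl), inv_mem_iff]⟩
  have hTI : ∀ x ∈ T ∩ H, ∃ l ∈ I, x = s l ∨ x = (s l)⁻¹ ∧ s l * s l ≠ 1 := by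
    rintro x ⟨hxT, hxH⟩
    obtain ⟨l, hl1, hlk, hl⟩ := hT.eq_or_eq_inv x hxT
    refine ⟨l, memI.2 ⟨⟨hl1, hlk⟩, ?_⟩, hl⟩
    rcases hl with rfl | ⟨rfl, -⟩
    exacts [hxH, inv_mem_iff.1 hxH]
  have hTJ : ∀ x ∈ T ∩ C, ∃ l ∈ J, x = s l ∨ x = (s l)⁻¹ ∧ s l * s l ≠ 1 := by
    rintro x ⟨hxT, hxC⟩
    obtain ⟨l, hl1, hlk, hl⟩ := hT.eq_or_eq_inv x hxT
    refine ⟨l, memJ.2 ⟨⟨hl1, hlk⟩, ?_⟩, hl⟩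
    rcases hl with rfl | ⟨rfl, -⟩
    exacts [Or.inl hxC, Or.inr hxC]
  have hτ : (T ∩ H).ncard ≤ 2 * I.card := ncard_le_two_mul_card fun x hx => by
    obtain ⟨l, hl, h | h⟩ := hTI x hx
    exacts [⟨l, hl, Or.inl h⟩, ⟨l, hl, Or.inr h.1⟩]
  have hc : (T ∩ C).ncard ≤ 2 * J.card := ncard_le_two_mul_card fun x hx => by
    obtain ⟨l, hl, h | h⟩ := hTJ x hx
    exacts [⟨l, hl, Or.inl h⟩, ⟨l, hl, Or.inr h.1⟩]
  have hτ' := hT.ncard_inter_lt H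
  have hcardJ : (J.erase j).card + 1 = J.card := Finset.card_erase_add_one hjJ
  have hdisj : Disjoint I (J.erase j) := hIJ.mono_right (Finset.erase_subset _ _)
  rcases Nat.eq_zero_or_pos I.card with hI0 | hIpos
  · left
    have : (T ∩ C).ncard ≤ C.ncard := Set.ncard_le_ncard Set.inter_subset_right
    rw [show C.ncard = Nat.card H from ncard_setOf_mul_inv_mem H (s j)] at this
    omega
  have hpow : ∀ n, n + 1 ≤ 2 ^ n := fun n => Nat.lt_two_pow_self
  by_cases hkind : (s j)⁻¹ ∈ T ∩ C ∧ s j * s j ≠ 1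
  · have hjj : s j * s j ∈ H := by
      have h : (s j)⁻¹ * (s j)⁻¹ ∈ H := hkind.1.2
      rwa [← mul_inv_rev, inv_mem_iff] at h
    by_cases hjfl : s j * s j ∈ flag s j
    · have hj2 : 2 ≤ j := by
        by_contra h
        obtain rfl : j = 1 := by omega
        rw [flag_one, Subgroup.mem_bot] at hjfl
        exact hkind.2 hjfl
      have h1I : 1 ∈ I := memI.2 ⟨⟨le_rfl, by omega⟩, hmin 1 le_rfl (by omega)⟩
      have hcardI := Finset.card_erase_add_one h1I
      have hbound : 3 * 2 ^ ((I.erase 1).card + (J.erase j).card) ≤ Nat.card H := by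
        have hdisj' : Disjoint (I.erase 1) (J.erase j) :=
          hdisj.mono_left (Finset.erase_subset _ _)
        rcases hj2.eq_or_lt with rfl | hj3
        · have h3 := hT.three_le_card_flag_two hjfl hkind.2
          have hfl : flag s 2 ≤ H := flag_le hmin
          have := card_inf_flag_mul_two_pow_le (s := s) H (I.erase 1 ∪ J.erase 2) 2 (by
            intro l hl
            rcases Finset.mem_union.1 hl with hl | hl
            · obtain ⟨hl1, hlI⟩ := Finset.mem_erase.1 hl
              have := (memI.1 hlI).1
              exact ⟨by omega, hgrowI l hlI⟩
            · exact ⟨(hJlt l hl).le, hgrowJ l hl⟩)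
          rw [inf_eq_right.2 hfl, Finset.card_union_of_disjoint hdisj'] at this
          exact (Nat.mul_le_mul_right _ h3).trans this
        · have h6 := hT.six_le_card_flag_three
          have hfl : flag s 3 ≤ H := flag_le fun i hi hi3 => hmin i hi (by omega)
          have h2I : 2 ∈ I.erase 1 :=
            Finset.mem_erase.2 ⟨by omega, memI.2 ⟨⟨by omega, by omega⟩, hmin 2 (by omega) hj3⟩⟩
          have := card_inf_flag_mul_two_pow_le (s := s) H ((I.erase 1).erase 2 ∪ J.erase j) 3 (by
            intro l hl
            rcases Finset.mem_union.1 hl with hl | hl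
            · obtain ⟨hl2, hl1, hlI⟩ := by simpa only [Finset.mem_erase] using hl
              have := (memI.1 hlI).1
              exact ⟨by omega, hgrowI l hlI⟩
            · exact ⟨by have := hJlt l hl; omega, hgrowJ l hl⟩)
          rw [inf_eq_right.2 hfl, Finset.card_union_of_disjoint
            (hdisj'.mono_left (Finset.erase_subset _ _))] at this
          have h2 := Finset.card_erase_add_one h2I
          rw [← h2, show ((I.erase 1).erase 2).card + 1 + (J.erase j).card =
            ((I.erase 1).erase 2).card + (J.erase j).card + 1 by ring, pow_succ]
          have := (Nat.mul_le_mul_right (2 ^ (((I.erase 1).erase 2).card + (J.erase j).card))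
            h6).trans this
          omega
      set a := (I.erase 1).card
      set b := (J.erase j).card
      rcases Nat.eq_zero_or_pos (a + b) with hab | hab
      · rw [hab] at hbound
        rcases hbound.eq_or_lt with h | h
        · right
          have hj : j = 2 := by
            by_contra hj
            have h2I : 2 ∈ I.erase 1 := Finset.mem_erase.2
              ⟨by omega, memI.2 ⟨⟨by omega, by omega⟩, hmin 2 (by omega) (by omega)⟩⟩
            have : 0 < a := Finset.card_pos.2 ⟨2, h2I⟩
            omega
          subst hj
          exact ⟨by omega, rfl, hjfl, hkind.2⟩
        · left
          omega
      · left
        obtain ⟨m, hm⟩ : ∃ m, a + b = m + 1 := ⟨a + b - 1, by omega⟩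
        rw [hm, pow_succ] at hbound
        have := hpow m
        omega
    · left
      have := card_inf_flag_mul_two_pow_le (s := s) H (I ∪ J) 0 (by
        intro l hl
        refine ⟨Nat.zero_le _, ?_⟩
        rcases Finset.mem_union.1 hl with hl | hl
        · exact hgrowI l hl
        · by_cases hlj : l = j
          · subst hlj
            exact ⟨_, hjj, mul_mem (mem_flag hj1 (by omega)) (mem_flag hj1 (by omega)), hjfl⟩
          · exact hgrowJ l (Finset.mem_erase.2 ⟨hlj, hl⟩))
      rw [Finset.card_union_of_disjoint hIJ] at this
      have hpos : 1 ≤ Nat.card (H ⊓ flag s 0 : Subgroup G) := Nat.card_pos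
      have := (Nat.mul_le_mul_right (2 ^ (I.card + J.card)) hpos).trans this
      obtain ⟨m, hm⟩ : ∃ m, I.card + J.card = m + 1 := ⟨I.card + J.card - 1, by omega⟩
      rw [hm, pow_succ] at this
      have := hpow m
      omega
  · left
    have hTJ' : ∀ x ∈ (T ∩ C) \ {s j}, ∃ l ∈ J.erase j, x = s l ∨ x = (s l)⁻¹ ∧
        s l * s l ≠ 1 := by
      rintro x ⟨hx, hxj⟩
      obtain ⟨l, hl, h⟩ := hTJ x hx
      refine ⟨l, Finset.mem_erase.2 ⟨?_, hl⟩, h⟩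
      rintro rfl
      rcases h with h | h
      · exact hxj h
      · exact hkind ⟨h.1 ▸ hx, h.2⟩
    have hc1 : (T ∩ C).ncard ≤ ((T ∩ C) \ {s j}).ncard + 1 := by
      have := Set.pred_ncard_le_ncard_sdiff_singleton (T ∩ C) (s j)
      omega
    have hc2 : ((T ∩ C) \ {s j}).ncard ≤ 2 * (J.erase j).card :=
      ncard_le_two_mul_card fun x hx => by
        obtain ⟨l, hl, h | h⟩ := hTJ' x hx
        exacts [⟨l, hl, Or.inl h⟩, ⟨l, hl, Or.inr h.1⟩]
    have hbound := card_inf_flag_mul_two_pow_le (s := s) H (I ∪ J.erase j) 0 (by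
      intro l hl
      refine ⟨Nat.zero_le _, ?_⟩
      rcases Finset.mem_union.1 hl with hl | hl
      exacts [hgrowI l hl, hgrowJ l hl])
    rw [Finset.card_union_of_disjoint hdisj] at hbound
    have hpos : 1 ≤ Nat.card (H ⊓ flag s 0 : Subgroup G) := Nat.card_pos
    replace hbound := (Nat.mul_le_mul_right (2 ^ (I.card + (J.erase j).card)) hpos).trans hbound
    rcases Nat.eq_zero_or_pos (J.erase j).card with hb | hb
    · omega
    by_cases hn : 3 ≤ I.card + (J.erase j).card
    · obtain ⟨m, hm⟩ : ∃ m, I.card + (J.erase j).card = m + 3 :=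
        ⟨I.card + (J.erase j).card - 3, by omega⟩
      rw [hm, pow_add] at hbound
      have := hpow m
      omega
    · obtain ⟨i, hi⟩ := Finset.card_eq_one.1 (show I.card = 1 by omega)
      obtain ⟨l, hl⟩ := Finset.card_eq_one.1 (show (J.erase j).card = 1 by omega)
      rw [hi, hl, Finset.card_singleton, Finset.card_singleton] at hbound
      by_contra hlt
      have hiI : i ∈ I := hi ▸ Finset.mem_singleton_self i
      have hlJ : l ∈ J.erase j := hl ▸ Finset.mem_singleton_self l
      rw [hi, Finset.card_singleton] at hτ
      rw [hl, Finset.card_singleton] at hc2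
      obtain ⟨x, y, hxy, hτeq⟩ := Set.ncard_eq_two.1 (show (T ∩ H).ncard = 2 by omega)
      obtain ⟨z, w, hzw, hceq⟩ := Set.ncard_eq_two.1 (show ((T ∩ C) \ {s j}).ncard = 2 by omega)
      have hTi : ∀ x ∈ T ∩ H, x = s i ∨ x = (s i)⁻¹ ∧ s i * s i ≠ 1 := by
        intro x hx
        obtain ⟨l, hl, h⟩ := hTI x hx
        rw [hi, Finset.mem_singleton] at hl
        exact hl ▸ h
      have hTl : ∀ x ∈ (T ∩ C) \ {s j}, x = s l ∨ x = (s l)⁻¹ ∧ s l * s l ≠ 1 := by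
        intro x hx
        obtain ⟨l', hl', h⟩ := hTJ' x hx
        rw [hl, Finset.mem_singleton] at hl'
        exact hl' ▸ h
      have hx : x ∈ T ∩ H := by rw [hτeq]; simp
      have hy : y ∈ T ∩ H := by rw [hτeq]; simp
      have hz : z ∈ (T ∩ C) \ {s j} := by rw [hceq]; simp
      have hw : w ∈ (T ∩ C) \ {s j} := by rw [hceq]; simp
      have hi2 : s i * s i ≠ 1 := by
        rcases hTi x hx with h | h
        · rcases hTi y hy with h' | h'
          · exact absurd (h.trans h'.symm) hxy
          · exact h'.2
        · exact h.2
      have hl2 : s l * s l ≠ 1 ∧ s l * (s j)⁻¹ ∈ H ∧ (s l)⁻¹ * (s j)⁻¹ ∈ H := by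
        rcases hTl z hz with h | h
        · rcases hTl w hw with h' | h'
          · exact absurd (h.trans h'.symm) hzw
          · exact ⟨h'.2, h ▸ hz.1.2, h'.1 ▸ hw.1.2⟩
        · rcases hTl w hw with h' | h'
          · exact ⟨h.2, h' ▸ hw.1.2, h.1 ▸ hz.1.2⟩
          · exact absurd (h.1.trans h'.1.symm) hzw
      have hi1 := (memI.1 hiI).1
      refine hl2.1 (hT.mul_self_eq_one_of_card_eq_four hj1 (hJlt l hlJ)
        (memJ.1 (Finset.mem_of_mem_erase hlJ)).1.2 hi1.1 hi1.2 ?_ (by omega)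
        (memI.1 hiI).2 hi2 hl2.2.1 hl2.2.2)
      rintro rfl
      exact Finset.disjoint_left.1 hdisj hiI hlJ

/-- A subgroup that is a part of the digraph has boundary at least `|T|`. -/
lemma ncard_le_ncard_Nout_subgroup (hT : IsHierarchicalSet s k T) {H : Subgroup G}
    (hH : IsPart (cayRel T) (H : Set G)) : T.ncard ≤ (Nout (cayRel T) (H : Set G)).ncard := by
  apply ncard_le_of_ncard_inter_le
  obtain ⟨g, hg⟩ := hH.2
  have hex : ∃ l, (1 ≤ l ∧ l ≤ k) ∧ s l ∉ H := by
    by_contra! h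
    have hle : flag s (k + 1) ≤ H := flag_le fun i hi hik => h i ⟨hi, by omega⟩
    rw [hT.flag_eq_top] at hle
    exact hg (Or.inl (hle (Subgroup.mem_top g)))
  obtain ⟨⟨hj1, hjk⟩, hjH⟩ := Nat.find_spec hex
  have hmin : ∀ i, 1 ≤ i → i < Nat.find hex → s i ∈ H := fun i hi hij => by
    by_contra h
    exact Nat.find_min hex hij ⟨⟨hi, by omega⟩, h⟩
  set j := Nat.find hex
  have hcoset : ∀ l, 1 ≤ l → l ≤ k → s l ∉ H →
      {g | g * (s l)⁻¹ ∈ H} \ T ⊆ Nout (cayRel T) (H : Set G) \ T := fun l h1 hk hl =>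
    Set.sdiff_subset_sdiff_left (setOf_mul_inv_mem_subset_Nout (hT.mem l h1 hk) hl)
  have hsplit : ∀ l, (T ∩ {g | g * (s l)⁻¹ ∈ H}).ncard + ({g | g * (s l)⁻¹ ∈ H} \ T).ncard =
      Nat.card H := fun l => by
    rw [Set.inter_comm, Set.ncard_inter_add_ncard_sdiff_eq_ncard, ncard_setOf_mul_inv_mem]
  rcases hT.ncard_inter_add_ncard_inter_le hj1 hjk hjH hmin with h | ⟨h3, hj, hfl, hne⟩
  · have h1 := Set.ncard_le_ncard (hcoset j hj1 hjk hjH)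
    have h2 := hsplit j
    omega
  · rw [hj] at hjH hmin
    have hτ := hT.ncard_inter_lt H
    have hflH : flag s 2 ≤ H := flag_le hmin
    have hHfl : H = flag s 2 :=
      (Subgroup.eq_of_le_of_card_ge hflH (h3 ▸ hT.three_le_card_flag_two hfl hne)).symm
    have hmiss : ∀ r, 1 ≤ r → r ≤ k → H ≤ flag s r →
        1 ≤ ({g | g * (s r)⁻¹ ∈ H} \ T).ncard := fun r h1 hk hr => by
      have h4 := Set.ncard_le_ncard (hT.inter_coset_subset h1 hk hr)
      have h5 := Set.ncard_insert_le (s r) {(s r)⁻¹}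
      rw [Set.ncard_singleton] at h5
      have h6 := hsplit r
      omega
    rcases hT.two_le.eq_or_lt with hk | hk
    · exfalso
      have hz : Subgroup.zpowers (s 2 * s 2) = H := by
        have : Fact (Nat.card H).Prime := ⟨h3 ▸ Nat.prime_three⟩
        have hle : Subgroup.zpowers (s 2 * s 2) ≤ H := by
          rw [Subgroup.zpowers_le]
          exact hflH hfl
        refine Subgroup.eq_of_le_of_card_ge hle ?_
        have h1 : 1 < Nat.card (Subgroup.zpowers (s 2 * s 2)) := by
          rw [Subgroup.one_lt_card_iff_ne_bot, Ne, Subgroup.zpowers_eq_bot]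
          exact hne
        exact ((Nat.dvd_prime this.out).1 (Subgroup.card_dvd_of_le hle)).elim
          (fun h => absurd h h1.ne') fun h => h.ge
      have hpow : ∀ n : ℤ, s 2 ^ (n + n) ∈ H := fun n => by
        rw [← hz]
        exact ⟨n, ((Commute.refl (s 2)).mul_zpow n).trans (zpow_add _ _ _).symm⟩
      have htop : (⊤ : Subgroup G) ≤ Subgroup.zpowers (s 2) := by
        rw [← hT.flag_eq_top]
        refine flag_le fun i hi hik => ?_
        obtain rfl | rfl : i = 1 ∨ i = 2 := by omega
        · have h1 : s 1 ∈ H := hmin 1 le_rfl (by omega)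
          rw [← hz] at h1
          exact (Subgroup.zpowers_le.2 (mul_mem (Subgroup.mem_zpowers _)
            (Subgroup.mem_zpowers _))) h1
        · exact Subgroup.mem_zpowers _
      obtain ⟨n, rfl⟩ := htop (Subgroup.mem_top g)
      rcases Int.even_or_odd' n with ⟨m, rfl | rfl⟩
      · exact hg (Or.inl (by simpa [two_mul] using hpow m))
      · refine hg (Or.inr (setOf_mul_inv_mem_subset_Nout (hT.mem 2 (by omega) hk.le) hjH ?_))
        simpa [two_mul, zpow_add_one] using hpow m
    · have hH3 : H ≤ flag s 3 := hHfl.le.trans (flag_mono (by omega))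
      have h2 := hmiss 2 (by omega) hk.le hHfl.le
      have h4 := hmiss 3 (by omega) hk hH3
      have h3H : s 3 ∉ H := fun h => hT.notMem_flag 3 (by omega) hk (hH3 h)
      have hdisj : Disjoint ({g | g * (s 2)⁻¹ ∈ H} \ T) ({g | g * (s 3)⁻¹ ∈ H} \ T) := by
        refine Set.disjoint_left.2 fun x hx hx' => hT.notMem_flag 3 (by omega) hk ?_
        have h5 := mul_mem (mul_mem (inv_mem (hH3 hx'.1)) (hH3 hx.1))
          (mem_flag (s := s) (show 1 ≤ 2 by omega) (show 2 < 3 by omega))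
        simpa [mul_assoc] using h5
      have h5 := Set.ncard_le_ncard (Set.union_subset (hcoset 2 (by omega) hk.le hjH)
        (hcoset 3 (by omega) hk h3H))
      rw [Set.ncard_union_eq hdisj] at h5
      omega

/-- The Cayley digraph of a hierarchical set is optimally connected. -/
lemma kappa_cayRel (hT : IsHierarchicalSet s k T) : kappa (cayRel T) = T.ncard := by
  refine kappa_cayRel_eq hT.one_notMem fun A hA => ?_
  by_contra! h
  obtain ⟨H, ⟨hH, hlt⟩ | ⟨hH, hlt⟩⟩ := exists_subgroup_ncard_Nout_lt hA h
  · exact hlt.not_ge (hT.ncard_le_ncard_Nout_subgroup hH)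
  · refine hlt.not_ge (le_of_eq_of_le ?_ (hT.inv.ncard_le_ncard_Nout_subgroup hH))
    rw [← Set.image_inv_eq_inv, Set.ncard_image_of_injective _ inv_injective]

end IsHierarchicalSet

/-- Hamidoune's theorem: if `Cay(G,S)` is hierarchical and connected, `S' ⊆ S⁻¹`
consists of elements of order at least three, and `|⟨s₁,s₂⟩| ≠ 4`, then
`Cay(G, S ∪ S')` is optimally vertex connected. -/
theorem stmt_16 {G : Type*} [Group G] [Finite G] [DecidableEq G]
    (k : ℕ) (hk : 2 ≤ k) (s : ℕ → G) (S' : Finset G)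
    (hne : ∀ i ∈ Finset.Icc 1 k, s i ≠ 1)
    (hhier : ∀ i ∈ Finset.Icc 1 k, ∀ j ∈ Finset.Icc 1 k, i ≠ j →
      Subgroup.closure (((Finset.Icc 1 i).image s : Finset G) : Set G) ≠
        Subgroup.closure (((Finset.Icc 1 j).image s : Finset G) : Set G))
    (hgen : Subgroup.closure (((Finset.Icc 1 k).image s : Finset G) : Set G) = ⊤)
    (hS' : ∀ t ∈ S', t⁻¹ ∈ (Finset.Icc 1 k).image s)
    (hord : ∀ t ∈ S', 3 ≤ orderOf t)
    (hcard : Nat.card (Subgroup.closure ({s 1, s 2} : Set G)) ≠ 4) :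
    kappa (cayRel ((((Finset.Icc 1 k).image s ∪ S' : Finset G)) : Set G)) =
      ((Finset.Icc 1 k).image s ∪ S').card := by
  have hflag : ∀ l, Subgroup.closure (((Finset.Icc 1 l).image s : Finset G) : Set G) =
      flag s (l + 1) := by
    intro l
    rw [flag, Finset.coe_image, Finset.coe_Icc]
    congr 2
    ext i
    simp only [Set.mem_Icc, Set.mem_Ico]
    omega
  simp only [hflag] at hhier hgen
  have hT : IsHierarchicalSet s k ((((Finset.Icc 1 k).image s ∪ S' : Finset G)) : Set G) := by
    refine ⟨fun l h1 hk h => ?_, hgen, fun l h1 hk => ?_, fun t ht => ?_, hk, ?_⟩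
    · rcases h1.eq_or_lt with rfl | h2
      · rw [flag_one, Subgroup.mem_bot] at h
        exact hne 1 (by simp; omega) h
      · refine hhier (l - 1) (by simp; omega) l (by simp; omega) (by omega) ?_
        rw [Nat.sub_add_cancel h1]
        refine le_antisymm (flag_mono (by omega)) (flag_le fun i hi hil => ?_)
        rcases (Nat.lt_succ_iff.1 hil).eq_or_lt with rfl | hlt
        exacts [h, mem_flag hi hlt]
    · exact Finset.mem_coe.2 (Finset.mem_union_left _
        (Finset.mem_image_of_mem _ (Finset.mem_Icc.2 ⟨h1, hk⟩)))
    · rcases Finset.mem_union.1 (Finset.mem_coe.1 ht) with ht | ht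
      · obtain ⟨l, hl, rfl⟩ := Finset.mem_image.1 ht
        exact ⟨l, (Finset.mem_Icc.1 hl).1, (Finset.mem_Icc.1 hl).2, Or.inl rfl⟩
      · obtain ⟨l, hl, hlt⟩ := Finset.mem_image.1 (hS' t ht)
        refine ⟨l, (Finset.mem_Icc.1 hl).1, (Finset.mem_Icc.1 hl).2,
          Or.inr ⟨by rw [hlt, inv_inv], fun h => ?_⟩⟩
        have h2 : t ^ 2 = 1 := by
          rw [hlt, ← mul_inv_rev, inv_eq_one] at h
          rw [pow_two, h]
        have := orderOf_le_of_pow_eq_one (by omega) h2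
        have := hord t ht
        omega
    · rwa [← hflag 2, Finset.coe_image, Finset.coe_Icc,
        show Set.Icc 1 2 = ({1, 2} : Set ℕ) by ext i; simp; omega, Set.image_pair]
  rw [hT.kappa_cayRel, Set.ncard_coe_finset]
end

section
/- For all n ≥ 2 and 1 ≤ k ≤ n−1, the cycle-prefix graph CP(n,k) is optimally vertex connected: κ(CP(n,k)) = n − 1. -/
open Classical

/-- The cycle-prefix permutation `γ(j)` (for `2 ≤ j ≤ n`), acting on `Fin n`
(0-indexed): it maps `0 ↦ j-1`, maps `i ↦ i-1` for `1 ≤ i ≤ j-1`, and fixes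
`i ≥ j`.  (1-indexed: `1 ↦ j`, `i ↦ i−1` for `2 ≤ i ≤ j`, fixes `i > j`.) -/
def gammaPerm (n j : ℕ) : Equiv.Perm (Fin n) :=
  if h : j - 1 < n then (Fin.cycleRange ⟨j - 1, h⟩)⁻¹ else 1

/-- The subgroup `H_k` of permutations fixing every `i` with `i < n - k`
(0-indexed), i.e. fixing the first `n-k` points. -/
def HkSub (n k : ℕ) : Subgroup (Equiv.Perm (Fin n)) :=
  fixingSubgroup (Equiv.Perm (Fin n)) {i : Fin n | (i : ℕ) < n - k}

section MoveToFront

variable {α : Type*} [DecidableEq α]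

/-- `l` is a sequence of `m` distinct elements of `S`. -/
def IsArrangement (S : Finset α) (m : ℕ) (l : List α) : Prop :=
  l.Nodup ∧ l.length = m ∧ ∀ x ∈ l, x ∈ S

/-- Move the letter `c` to the front (inserting it if absent), and keep the first `m` letters. -/
def moveToFront (m : ℕ) (c : α) (l : List α) : List α :=
  (c :: l.erase c).take m

theorem List.take_erase_take_succ (l : List α) (c : α) (k : ℕ) :
    ((l.take (k + 1)).erase c).take k = (l.erase c).take k := by
  induction l generalizing k with
  | nil => simp
  | cons x t ih =>
    by_cases h : x = c
    · subst h; simp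
    · cases k with
      | zero => simp
      | succ k =>
        rw [List.take_succ_cons, List.erase_cons_tail (by simpa using h),
          List.erase_cons_tail (by simpa using h), List.take_succ_cons, List.take_succ_cons, ih]

theorem moveToFront_succ (m : ℕ) (c : α) (l : List α) :
    moveToFront (m + 1) c l = c :: (l.erase c).take m := by
  simp [moveToFront]

theorem moveToFront_take (m : ℕ) (c : α) (l : List α) :
    moveToFront (m + 1) c (l.take (m + 1)) = (c :: l.erase c).take (m + 1) := by
  rw [moveToFront_succ, List.take_erase_take_succ, List.take_succ_cons]

/-- Deleting `c` intertwines moving `d` to the front of sequences of consecutive lengths. -/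
theorem take_erase_moveToFront {c d : α} (h : d ≠ c) (k : ℕ) (l : List α) :
    ((moveToFront (k + 2) d l).erase c).take (k + 1) =
      moveToFront (k + 1) d ((l.erase c).take (k + 1)) := by
  rw [moveToFront_succ, moveToFront_succ, List.erase_cons_tail (by simpa using h),
    List.take_succ_cons, List.take_erase_take_succ, List.take_erase_take_succ, List.erase_comm]

theorem IsArrangement.moveToFront_self {S : Finset α} {m : ℕ} {c : α} {t : List α}
    (h : IsArrangement S m (c :: t)) : moveToFront m c (c :: t) = c :: t := by
  obtain ⟨-, h, -⟩ := h
  simp [moveToFront, ← h]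

theorem IsArrangement.moveToFront {S : Finset α} {m : ℕ} {c : α} {l : List α}
    (h : IsArrangement S m l) (hc : c ∈ S) : IsArrangement S m (moveToFront m c l) := by
  obtain ⟨h1, h2, h3⟩ := h
  refine ⟨?_, ?_, ?_⟩
  · refine List.Nodup.sublist (List.take_sublist _ _) ?_
    rw [List.nodup_cons]
    exact ⟨h1.not_mem_erase, h1.erase c⟩
  · have := List.length_erase_add_one (a := c) (l := l)
    by_cases hcl : c ∈ l
    · have := this hcl
      simp [_root_.moveToFront]; omega
    · simp [_root_.moveToFront, List.erase_of_not_mem hcl]; omega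
  · intro x hx
    have := List.mem_of_mem_take hx
    rcases List.mem_cons.1 this with rfl | h
    · exact hc
    · exact h3 x (List.mem_of_mem_erase h)

/-- Deleting `c` from an arrangement and truncating. -/
theorem IsArrangement.take_erase {S : Finset α} {m : ℕ} {c : α} {l : List α}
    (h : IsArrangement S (m + 1) l) :
    IsArrangement (S.erase c) m ((l.erase c).take m) := by
  obtain ⟨h1, h2, h3⟩ := h
  refine ⟨(h1.erase c).sublist (List.take_sublist _ _), ?_, fun x hx => ?_⟩
  · rw [List.length_take, List.length_erase]
    split_ifs <;> omega
  · have hx := List.mem_of_mem_take hx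
    rw [h1.mem_erase_iff] at hx
    exact Finset.mem_erase.2 ⟨hx.1, h3 x hx.2⟩

/-- An arrangement with at least two letters has at least `|S| - 1` proper predecessors under
the moves to front, all of which start with its second letter. -/
theorem IsArrangement.exists_predecessors {S : Finset α} {k : ℕ} {c d : α} {y : List α}
    (h : IsArrangement S (k + 2) (c :: d :: y)) :
    ∃ P : Finset (List α), S.card ≤ P.card + 1 ∧ ∀ p ∈ P, IsArrangement S (k + 2) p ∧
      p.head? = some d ∧ _root_.moveToFront (k + 2) c p = c :: d :: y := by
  obtain ⟨h1, h2, h3⟩ := h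
  have hy : y.length = k := by simpa using h2
  simp only [List.nodup_cons, List.mem_cons, not_or] at h1
  obtain ⟨⟨hcd, hcy⟩, hdy, hyn⟩ := h1
  have hcS : c ∈ S := h3 c (by simp)
  have hdS : d ∈ S := h3 d (by simp)
  have hyS : ∀ x ∈ y, x ∈ S := fun x hx => h3 x (by simp [hx])
  set f : ℕ → List α := fun i => d :: (y.take i ++ c :: y.drop i) with hf
  set g : α → List α := fun z => d :: (y ++ [z]) with hg
  set Q : Finset α := S \ (c :: d :: y).toFinset with hQ
  have hmemf : ∀ i x, x ∈ f i ↔ x ∈ c :: d :: y := by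
    intro i x
    have : x ∈ y ↔ x ∈ y.take i ∨ x ∈ y.drop i := by
      rw [← List.mem_append, List.take_append_drop]
    simp only [hf, List.mem_cons, List.mem_append, this]
    tauto
  refine ⟨(Finset.range (k + 1)).image f ∪ Q.image g, ?_, ?_⟩
  · have hdisj : Disjoint ((Finset.range (k + 1)).image f) (Q.image g) := by
      rw [Finset.disjoint_left]
      intro p hp hp'
      obtain ⟨i, -, rfl⟩ := Finset.mem_image.1 hp
      obtain ⟨z, hz, hzi⟩ := Finset.mem_image.1 hp'
      have hc : c ∈ f i := (hmemf i c).2 (by simp)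
      rw [← hzi] at hc
      simp only [hQ, Finset.mem_sdiff, List.mem_toFinset, List.mem_cons, not_or] at hz
      simp only [hg, List.mem_cons, List.mem_append, List.not_mem_nil, or_false] at hc
      rcases hc with hc | hc | hc
      · exact hcd hc
      · exact hcy hc
      · exact hz.2.1 hc.symm
    rw [Finset.card_union_of_disjoint hdisj, Finset.card_image_of_injOn, Finset.card_image_of_injOn,
      Finset.card_range]
    · have h4 : (c :: d :: y).toFinset.card = k + 2 := by
        rw [List.toFinset_card_of_nodup, h2]
        simp [hcd, hcy, hdy, hyn]
      have : S.card - (c :: d :: y).toFinset.card ≤ Q.card := Finset.le_card_sdiff _ _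
      omega
    · intro z _ z' _ hzz
      simpa [hg] using hzz
    · intro i hi j hj hij
      have hidx : ∀ i ≤ k, (y.take i ++ c :: y.drop i).idxOf c = i := by
        intro i hi
        rw [List.idxOf_append_of_notMem (fun h => hcy (List.mem_of_mem_take h))]
        simp; omega
      simp only [Finset.coe_range, Set.mem_Iio] at hi hj
      rw [← hidx i (by omega), ← hidx j (by omega)]
      simp only [hf, List.cons.injEq, true_and] at hij
      rw [hij]
  · intro p hp
    rcases Finset.mem_union.1 hp with hp | hp
    · obtain ⟨i, hi, rfl⟩ := Finset.mem_image.1 hp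
      have hperm : (f i).Perm (c :: d :: y) := by
        refine ((List.perm_middle).cons d).trans ?_
        rw [List.take_append_drop]
        exact List.Perm.swap _ _ _
      refine ⟨⟨?_, ?_, ?_⟩, rfl, ?_⟩
      · rw [hperm.nodup_iff]
        simp [hcd, hcy, hdy, hyn]
      · rw [hperm.length_eq, h2]
      · intro x hx
        exact h3 x ((hmemf i x).1 hx)
      · simp only [hf, _root_.moveToFront]
        rw [List.erase_cons_tail (by simpa using Ne.symm hcd),
          List.erase_append_right _ (fun h => hcy (List.mem_of_mem_take h)),
          List.erase_cons_head, List.take_append_drop, List.take_of_length_le (by simp [hy])]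
    · obtain ⟨z, hz, rfl⟩ := Finset.mem_image.1 hp
      simp only [hQ, Finset.mem_sdiff, List.mem_toFinset, List.mem_cons, not_or] at hz
      obtain ⟨hzS, hzc, hzd, hzy⟩ := hz
      refine ⟨⟨?_, ?_, ?_⟩, rfl, ?_⟩
      · simp only [hg]
        rw [List.nodup_cons, ← List.concat_eq_append, List.nodup_concat]
        simp [hdy, hyn, hzy, Ne.symm hzd]
      · simp [hg, hy]
      · intro x hx
        simp only [hg, List.mem_cons, List.mem_append, List.not_mem_nil, or_false] at hx
        rcases hx with rfl | hx | rfl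
        exacts [hdS, hyS x hx, hzS]
      · simp only [hg, _root_.moveToFront]
        rw [List.erase_of_not_mem (by simp [hcd, hcy, Ne.symm hzc])]
        simp [← hy]

theorem prefix_foldr_moveToFront {m : ℕ} (p : List α) : ∀ w : List α, w.Nodup → w.length ≤ m →
    w <+: w.foldr (moveToFront m) p
  | [], _, _ => List.nil_prefix
  | c :: w, hw, hm => by
    rw [List.nodup_cons] at hw
    have hm' : w.length + 1 ≤ m := hm
    obtain ⟨t, ht⟩ := prefix_foldr_moveToFront (m := m) p w hw.2 (by omega)
    rw [List.foldr_cons, ← ht, moveToFront, List.erase_append_right _ hw.1, ← List.cons_append]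
    rw [List.prefix_take_iff]
    exact ⟨List.prefix_append _ _, hm⟩

/-- A nonempty set `A` of arrangements whose boundary under the moves to front lies in a set `N`
with `|N| ≤ |S| - 2` contains every arrangement outside `N`. -/
theorem IsArrangement.mem_union_of_closed (k : ℕ) : ∀ (S : Finset α) (A N : Finset (List α)),
    (∀ a ∈ A, IsArrangement S (k + 1) a) → A.Nonempty →
    (∀ a ∈ A, ∀ c ∈ S, _root_.moveToFront (k + 1) c a ∈ A ∪ N) → N.card + 2 ≤ S.card →
    ∀ b, IsArrangement S (k + 1) b → b ∈ A ∪ N := by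
  induction k with
  | zero =>
    rintro S A N - ⟨a, ha⟩ hcl - b ⟨-, hb, hbS⟩
    obtain ⟨x, rfl⟩ := List.length_eq_one_iff.1 hb
    simpa [_root_.moveToFront] using hcl a ha x (hbS x (by simp))
  | succ k ih =>
    intro S A N hA hne hcl hcard b hb
    have hpred : ∀ p c, IsArrangement S (k + 2) p → c ∈ S →
        _root_.moveToFront (k + 2) c p ∉ A ∪ N → p ∉ A ∪ N := by
      intro p c hp hc hq hpAN
      have hpN : p ∈ N := (Finset.mem_union.1 hpAN).resolve_left fun h => hq (hcl p h c hc)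
      obtain ⟨d, t, rfl⟩ : ∃ d t, p = d :: t :=
        List.exists_cons_of_length_eq_add_one hp.2.1
      by_cases hdc : d = c
      · subst hdc
        rw [hp.moveToFront_self] at hq
        exact hq hpAN
      have hdS : d ∈ S := hp.2.2 d (by simp)
      have hq2 : _root_.moveToFront (k + 2) c (d :: t) = c :: d :: (t.erase c).take k := by
        rw [moveToFront_succ, List.erase_cons_tail (by simpa using hdc), List.take_succ_cons]
      have hqa := hp.moveToFront hc
      rw [hq2] at hq hqa
      obtain ⟨P, hPcard, hP⟩ := hqa.exists_predecessors
      set N₁ := N.filter (fun l => l.head? = some d) with hN₁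
      set N₂ := N.filter (fun l => ¬ l.head? = some d) with hN₂
      set r : List α → List α := fun l => (l.erase d).take (k + 1) with hr
      have hsum : N₁.card + N₂.card = N.card :=
        Finset.card_filter_add_card_filter_not (s := N) (fun l => l.head? = some d)
      have hpos : 0 < N₁.card := Finset.card_pos.2 ⟨d :: t, by simp [hN₁, hpN]⟩
      have hN₂card : (N₂.image r).card ≤ N₂.card := Finset.card_image_le
      have key := ih (S.erase d) (A.image r) (N₂.image r)
        (by
          intro x hx
          obtain ⟨a, ha, rfl⟩ := Finset.mem_image.1 hx
          exact (hA a ha).take_erase)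
        (hne.image r)
        (by
          intro x hx e he
          obtain ⟨a, ha, rfl⟩ := Finset.mem_image.1 hx
          obtain ⟨hed, heS⟩ := Finset.mem_erase.1 he
          rw [hr, ← take_erase_moveToFront hed]
          rcases Finset.mem_union.1 (hcl a ha e heS) with h | h
          · exact Finset.mem_union_left _ (Finset.mem_image_of_mem r h)
          · refine Finset.mem_union_right _ (Finset.mem_image_of_mem r ?_)
            exact Finset.mem_filter.2 ⟨h, by simp [moveToFront_succ, hed]⟩)
        (by rw [Finset.card_erase_of_mem hdS]; omega)
      have hsub : P ⊆ N₁ ∪ (N₂.image r).image (List.cons d) := by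
        intro p hpP
        obtain ⟨hpa, hpd, hpq⟩ := hP p hpP
        by_cases hpN : p ∈ N
        · exact Finset.mem_union_left _ (by simp [hN₁, hpN, hpd])
        have hpA : p ∉ A := fun h => hq (hpq ▸ hcl p h c hc)
        obtain ⟨x, rfl⟩ : ∃ x, p = d :: x := by
          cases p with
          | nil => simp at hpd
          | cons u x => exact ⟨x, by simpa using hpd⟩
        have hx : IsArrangement (S.erase d) (k + 1) x := by
          have h := hpa.take_erase (c := d)
          have hl : x.length = k + 1 := by simpa using hpa.2.1
          rwa [List.erase_cons_head, List.take_of_length_le hl.le] at h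
        rcases Finset.mem_union.1 (key x hx) with h | h
        · obtain ⟨a, ha, rfl⟩ := Finset.mem_image.1 h
          have := hcl a ha d hdS
          rw [moveToFront_succ] at this
          exact absurd this (by simpa using ⟨hpA, hpN⟩)
        · exact Finset.mem_union_right _ (Finset.mem_image_of_mem _ h)
      have h1 := Finset.card_le_card hsub
      have h2 := Finset.card_union_le N₁ ((N₂.image r).image (List.cons d))
      have h3 : ((N₂.image r).image (List.cons d)).card ≤ (N₂.image r).card :=
        Finset.card_image_le
      omega
    by_contra hbB
    obtain ⟨a, ha⟩ := hne
    have hfold : ∀ w : List α, (∀ x ∈ w, x ∈ S) →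
        IsArrangement S (k + 2) (w.foldr (_root_.moveToFront (k + 2)) a) ∧
        (w.foldr (_root_.moveToFront (k + 2)) a ∈ A ∪ N) := by
      intro w
      induction w with
      | nil => exact fun _ => ⟨hA a ha, Finset.mem_union_left _ ha⟩
      | cons c w ihw =>
        intro hw
        obtain ⟨h1, h2⟩ := ihw fun x hx => hw x (by simp [hx])
        have hc := hw c (by simp)
        exact ⟨h1.moveToFront hc, by_contra fun h => hpred _ c h1 hc h h2⟩
    obtain ⟨h1, h2⟩ := hfold b hb.2.2
    have h3 := (prefix_foldr_moveToFront a b hb.1 hb.2.1.le).eq_of_length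
      (hb.2.1.trans h1.2.1.symm)
    rw [← h3] at h2
    exact hbB h2

end MoveToFront

section CyclePrefix

/-- The first `m` values of a permutation, as a list. -/
def permPrefix (n m : ℕ) (g : Equiv.Perm (Fin n)) : List (Fin n) :=
  ((List.finRange n).map g).take m

theorem isArrangement_permPrefix {n m : ℕ} (hm : m ≤ n) (g : Equiv.Perm (Fin n)) :
    IsArrangement Finset.univ m (permPrefix n m g) :=
  ⟨((List.nodup_finRange n).map g.injective).sublist (List.take_sublist _ _),
    by simpa [permPrefix] using hm, fun _ _ => Finset.mem_univ _⟩

theorem permPrefix_eq_iff {n m : ℕ} {g h : Equiv.Perm (Fin n)} :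
    permPrefix n m g = permPrefix n m h ↔ ∀ i : Fin n, (i : ℕ) < m → g i = h i := by
  constructor
  · intro hgh i hi
    have := congrArg (fun l => l[(i : ℕ)]?) hgh
    simpa [permPrefix, List.getElem?_take, hi] using this
  · intro hgh
    refine List.ext_getElem (by simp [permPrefix]) fun i hi _ => ?_
    simp only [permPrefix, List.length_take, List.length_map, List.length_finRange] at hi
    simpa [permPrefix] using hgh ⟨i, by omega⟩ (by simp; omega)

theorem mem_HkSub_iff {n k : ℕ} {g : Equiv.Perm (Fin n)} :
    g ∈ HkSub n k ↔ ∀ i : Fin n, (i : ℕ) < n - k → g i = i := by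
  simp [HkSub, mem_fixingSubgroup_iff]

theorem mk_eq_mk_iff_permPrefix {n k : ℕ} {g h : Equiv.Perm (Fin n)} :
    (g : Equiv.Perm (Fin n) ⧸ HkSub n k) = h ↔
      permPrefix n (n - k) g = permPrefix n (n - k) h := by
  rw [QuotientGroup.eq, mem_HkSub_iff, permPrefix_eq_iff]
  refine forall₂_congr fun i _ => ?_
  rw [Equiv.Perm.mul_apply, Equiv.Perm.inv_eq_iff_eq, eq_comm]

theorem map_succAbove_finRange (n : ℕ) (p : Fin (n + 1)) :
    (List.finRange n).map p.succAbove = (List.finRange (n + 1)).erase p := by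
  rw [List.erase_eq_eraseIdx_of_idxOf (List.idxOf_finRange p)]
  refine List.ext_getElem (by simp [List.length_eraseIdx]; omega) fun i hi _ => ?_
  rw [List.getElem_eraseIdx]
  ext
  simp only [List.length_map, List.length_finRange] at hi
  simp only [List.getElem_map, List.getElem_finRange, Fin.succAbove, Fin.lt_def]
  split_ifs <;> simp_all

theorem map_cycleRange_inv_finRange (n : ℕ) (p : Fin (n + 1)) :
    (List.finRange (n + 1)).map ⇑(p.cycleRange)⁻¹ = p :: (List.finRange (n + 1)).erase p := by
  rw [← map_succAbove_finRange, List.finRange_succ, List.map_cons, List.map_map]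
  simp [Equiv.Perm.inv_def, Function.comp_def]

theorem gammaPerm_succ {n : ℕ} (p : Fin n) : gammaPerm n (p + 1) = (p.cycleRange)⁻¹ := by
  simp [gammaPerm]

/-- Right multiplication by a cycle-prefix permutation moves a letter to the front. -/
theorem permPrefix_mul_gammaPerm {n m : ℕ} (g : Equiv.Perm (Fin (n + 1))) (p : Fin (n + 1)) :
    permPrefix (n + 1) (m + 1) (g * gammaPerm (n + 1) (p + 1)) =
      moveToFront (m + 1) (g p) (permPrefix (n + 1) (m + 1) g) := by
  rw [permPrefix, permPrefix, moveToFront_take, gammaPerm_succ, Equiv.Perm.coe_mul,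
    ← List.map_map, map_cycleRange_inv_finRange, List.map_cons, List.map_erase g.injective]

/-- The edge relation of the cycle-prefix graph. -/
abbrev cpRel (n k : ℕ) :
    Equiv.Perm (Fin n) ⧸ HkSub n k → Equiv.Perm (Fin n) ⧸ HkSub n k → Prop :=
  cayleyRel (HkSub n k) {g | ∃ j, 2 ≤ j ∧ j ≤ n - k + 1 ∧ g = gammaPerm n j}

theorem cpRel_mk_gammaPerm {n k : ℕ} (g h : Equiv.Perm (Fin (n + 1))) (hh : h ∈ HkSub (n + 1) k)
    {p : Fin (n + 1)} (hp : p ≠ 0) (hpk : (p : ℕ) ≤ n + 1 - k) :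
    cpRel (n + 1) k g (g * h * gammaPerm (n + 1) (p + 1) : Equiv.Perm (Fin (n + 1))) := by
  have : (p : ℕ) ≠ 0 := fun h => hp (Fin.ext h)
  exact ⟨_, ⟨p + 1, by omega, by omega, rfl⟩, _, _, rfl, rfl, h, hh, 1, one_mem _, by group⟩

/-- Every move to front is either trivial or an edge of the cycle-prefix graph. -/
theorem exists_permPrefix_eq_moveToFront {n k : ℕ} (hk : k ≤ n)
    (g : Equiv.Perm (Fin (n + 1))) (c : Fin (n + 1)) :
    ∃ h : Equiv.Perm (Fin (n + 1)),
      permPrefix (n + 1) (n + 1 - k) h =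
        moveToFront (n + 1 - k) c (permPrefix (n + 1) (n + 1 - k) g) ∧
      ((h : Equiv.Perm (Fin (n + 1)) ⧸ HkSub (n + 1) k) = g ∨ cpRel (n + 1) k g h) := by
  obtain ⟨m, hm⟩ : ∃ m, n + 1 - k = m + 1 := ⟨n - k, by omega⟩
  obtain ⟨p, rfl⟩ := g.surjective c
  by_cases hp0 : p = 0
  · refine ⟨g * gammaPerm (n + 1) (p + 1), ?_, Or.inl ?_⟩
    · rw [hm, permPrefix_mul_gammaPerm]
    · subst hp0
      rw [gammaPerm_succ, Fin.cycleRange_zero, inv_one, mul_one]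
  by_cases hpm : (p : ℕ) ≤ n + 1 - k
  · refine ⟨g * gammaPerm (n + 1) (p + 1), ?_, Or.inr ?_⟩
    · rw [hm, permPrefix_mul_gammaPerm]
    · simpa using cpRel_mk_gammaPerm g 1 (one_mem _) hp0 hpm
  · set q : Fin (n + 1) := ⟨n + 1 - k, by omega⟩ with hq
    have hsw : Equiv.swap q p ∈ HkSub (n + 1) k := by
      rw [mem_HkSub_iff]
      intro i hi
      refine Equiv.swap_apply_of_ne_of_ne ?_ ?_
      · rintro rfl; simp [hq] at hi
      · rintro rfl; omega
    refine ⟨g * Equiv.swap q p * gammaPerm (n + 1) (q + 1), ?_, Or.inr ?_⟩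
    · have : permPrefix (n + 1) (n + 1 - k) (g * Equiv.swap q p) =
          permPrefix (n + 1) (n + 1 - k) g := by
        rw [← mk_eq_mk_iff_permPrefix, eq_comm, QuotientGroup.eq]
        simpa using hsw
      rw [← this, hm, permPrefix_mul_gammaPerm]
      simp
    · refine cpRel_mk_gammaPerm g _ hsw ?_ le_rfl
      simp only [hq, ne_eq, Fin.ext_iff, Fin.val_zero]
      omega

/-- Every edge of the cycle-prefix graph moves a letter other than the first one to the front. -/
theorem cpRel.exists_moveToFront {n k : ℕ} (hk1 : 1 ≤ k) (hk : k ≤ n)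
    {g h : Equiv.Perm (Fin (n + 1))} (hE : cpRel (n + 1) k g h) :
    ∃ c, c ≠ g 0 ∧ permPrefix (n + 1) (n + 1 - k) h =
      moveToFront (n + 1 - k) c (permPrefix (n + 1) (n + 1 - k) g) := by
  obtain ⟨_, ⟨j, hj2, hjm, rfl⟩, g₁, g₂, hg₁, hg₂, h₁, hh₁, h₂, hh₂, heq⟩ := hE
  obtain ⟨m, hm⟩ : ∃ m, n + 1 - k = m + 1 := ⟨n - k, by omega⟩
  obtain ⟨p, rfl⟩ : ∃ p : Fin (n + 1), j = p + 1 := ⟨⟨j - 1, by omega⟩, by simp; omega⟩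
  have hg₁' : permPrefix (n + 1) (n + 1 - k) (g₁ * h₁) = permPrefix (n + 1) (n + 1 - k) g := by
    rw [← mk_eq_mk_iff_permPrefix, ← hg₁, eq_comm, QuotientGroup.eq]
    simpa using hh₁
  have hg₂' : permPrefix (n + 1) (n + 1 - k) (g₁ * h₁ * gammaPerm (n + 1) (p + 1)) =
      permPrefix (n + 1) (n + 1 - k) h := by
    rw [← mk_eq_mk_iff_permPrefix, ← hg₂, QuotientGroup.eq, eq_mul_of_inv_mul_eq heq]
    simpa [mul_assoc] using hh₂
  refine ⟨(g₁ * h₁) p, ?_, ?_⟩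
  · rw [← permPrefix_eq_iff.1 hg₁' 0 (by simp; omega)]
    intro h0
    have := (g₁ * h₁).injective h0
    subst this
    simp at hj2
  · rw [← hg₂', ← hg₁', hm, permPrefix_mul_gammaPerm]

/-- Deleting fewer than `n` vertices leaves a cycle-prefix graph on `n + 1` letters strongly
connected. -/
theorem le_ncard_of_not_SCOn {n k : ℕ} (hk : k ≤ n)
    (T : Set (Equiv.Perm (Fin (n + 1)) ⧸ HkSub (n + 1) k)) (hT : ¬ SCOn (cpRel (n + 1) k) Tᶜ) :
    n ≤ T.ncard := by
  by_contra! hlt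
  apply hT
  intro a ha b hb
  obtain ⟨m, hm⟩ : ∃ m, n + 1 - k = m + 1 := ⟨n - k, by omega⟩
  set φ : Equiv.Perm (Fin (n + 1)) ⧸ HkSub (n + 1) k → List (Fin (n + 1)) :=
    fun x => permPrefix (n + 1) (n + 1 - k) x.out with hφ
  have hφmk : ∀ g : Equiv.Perm (Fin (n + 1)), φ g = permPrefix (n + 1) (n + 1 - k) g := fun g =>
    mk_eq_mk_iff_permPrefix.1 (QuotientGroup.out_eq' _)
  have hφinj : Function.Injective φ := by
    intro x y hxy
    have := mk_eq_mk_iff_permPrefix.2 hxy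
    rwa [QuotientGroup.out_eq', QuotientGroup.out_eq'] at this
  set R : Set (Equiv.Perm (Fin (n + 1)) ⧸ HkSub (n + 1) k) :=
    {x | Relation.ReflTransGen (fun x y => x ∈ Tᶜ ∧ y ∈ Tᶜ ∧ cpRel (n + 1) k x y) a x} with hR
  have hRT : ∀ x ∈ R, x ∈ Tᶜ := by
    intro x hx
    rcases Relation.ReflTransGen.cases_tail hx with rfl | ⟨y, -, h⟩
    exacts [ha, h.2.1]
  have harr : ∀ x, IsArrangement Finset.univ (m + 1) (φ x) := fun x =>
    hm ▸ isArrangement_permPrefix (Nat.sub_le _ _) _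
  have key := IsArrangement.mem_union_of_closed m Finset.univ
    (R.toFinite.toFinset.image φ) (T.toFinite.toFinset.image φ)
    (by
      intro l hl
      obtain ⟨x, -, rfl⟩ := Finset.mem_image.1 hl
      exact harr x)
    ⟨φ a, Finset.mem_image_of_mem φ (by simpa [hR] using Relation.ReflTransGen.refl)⟩
    (by
      intro l hl c _
      obtain ⟨x, hx, rfl⟩ := Finset.mem_image.1 hl
      have hx : x ∈ R := (Set.Finite.mem_toFinset _).1 hx
      obtain ⟨h, hh, hE⟩ := exists_permPrefix_eq_moveToFront hk x.out c
      rw [← hm, ← hh, ← hφmk]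
      rw [QuotientGroup.out_eq'] at hE
      by_cases hhT : (h : Equiv.Perm (Fin (n + 1)) ⧸ HkSub (n + 1) k) ∈ T
      · exact Finset.mem_union_right _ (Finset.mem_image_of_mem φ (by simpa using hhT))
      · refine Finset.mem_union_left _ (Finset.mem_image_of_mem φ ?_)
        rw [Set.Finite.mem_toFinset]
        rcases hE with hE | hE
        · rwa [hE]
        · exact Relation.ReflTransGen.tail hx ⟨hRT x hx, hhT, hE⟩)
    (by
      rw [Finset.card_image_of_injective _ hφinj, ← Set.ncard_eq_toFinset_card, Finset.card_univ,
        Fintype.card_fin]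
      omega)
    (φ b) (harr b)
  rcases Finset.mem_union.1 key with h | h
  · rw [hφinj.mem_finset_image, Set.Finite.mem_toFinset] at h
    exact h
  · rw [hφinj.mem_finset_image, Set.Finite.mem_toFinset] at h
    exact absurd h hb

/-- Permutations of at least three letters, with at least two of them remembered: deleting the
out-neighbours of the identity coset disconnects the cycle-prefix graph. -/
theorem exists_ncard_le_not_SCOn {n k : ℕ} (hk1 : 1 ≤ k) (hk : k < n) :
    ∃ T : Set (Equiv.Perm (Fin (n + 1)) ⧸ HkSub (n + 1) k),
      T.ncard ≤ n ∧ ¬ SCOn (cpRel (n + 1) k) Tᶜ := by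
  obtain ⟨m, hm⟩ : ∃ m, n + 1 - k = m + 1 := ⟨n - k, by omega⟩
  set e : Equiv.Perm (Fin (n + 1)) ⧸ HkSub (n + 1) k := QuotientGroup.mk 1 with he
  set T : Set (Equiv.Perm (Fin (n + 1)) ⧸ HkSub (n + 1) k) := {y | cpRel (n + 1) k e y} with hT
  have hfix : ∀ h : Equiv.Perm (Fin (n + 1)), h 0 = 0 →
      (h : Equiv.Perm (Fin (n + 1)) ⧸ HkSub (n + 1) k) ∉ T := by
    intro h h0 hE
    obtain ⟨c, hc, hp⟩ := cpRel.exists_moveToFront hk1 hk.le hE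
    rw [hm, moveToFront_succ] at hp
    have := congrArg List.head? hp
    simp [permPrefix, List.finRange_succ, h0] at this
    exact hc this.symm
  refine ⟨T, ?_, fun hSC => ?_⟩
  · set φ : Equiv.Perm (Fin (n + 1)) ⧸ HkSub (n + 1) k → List (Fin (n + 1)) :=
      fun x => permPrefix (n + 1) (n + 1 - k) x.out with hφ
    have hφinj : Function.Injective φ := by
      intro x y hxy
      have := mk_eq_mk_iff_permPrefix.2 hxy
      rwa [QuotientGroup.out_eq', QuotientGroup.out_eq'] at this
    set I : Finset (List (Fin (n + 1))) := (Finset.univ.erase 0).image fun c =>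
      moveToFront (n + 1 - k) c (permPrefix (n + 1) (n + 1 - k) 1) with hI
    have hIcard : I.card ≤ n := Finset.card_image_le.trans (by simp)
    rw [← Set.ncard_image_of_injective T hφinj]
    refine le_trans ?_ hIcard
    rw [← Set.ncard_coe_finset]
    refine Set.ncard_le_ncard ?_ I.finite_toSet
    rintro _ ⟨y, hy, rfl⟩
    have hy' : cpRel (n + 1) k e (y.out : Equiv.Perm (Fin (n + 1))) := by
      rw [QuotientGroup.out_eq']; exact hy
    obtain ⟨c, hc, hp⟩ := cpRel.exists_moveToFront hk1 hk.le hy'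
    exact Finset.mem_image.2 ⟨c, by simpa using hc, hp.symm⟩
  · have h1 : (1 : Fin (n + 1)) ≠ 0 := by
      simp [Fin.ext_iff]; omega
    obtain ⟨q, hq⟩ : ∃ q : Fin (n + 1), (q : ℕ) = 2 := ⟨⟨2, by omega⟩, rfl⟩
    have hv1 : ((1 : Fin (n + 1)) : ℕ) = 1 := by
      rw [Fin.val_one', Nat.mod_eq_of_lt (by omega)]
    set h : Equiv.Perm (Fin (n + 1)) := Equiv.swap 1 q with hh
    have hhT := hfix h (Equiv.swap_apply_of_ne_of_ne h1.symm (by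
      intro h; rw [← h] at hq; simp at hq))
    have hne : e ≠ h := by
      intro heq
      have := permPrefix_eq_iff.1 (mk_eq_mk_iff_permPrefix.1 heq) 1 (by omega)
      rw [hh, Equiv.swap_apply_left, Equiv.Perm.one_apply, Fin.ext_iff] at this
      omega
    rcases Relation.ReflTransGen.cases_head (hSC e (hfix 1 rfl) h hhT) with heq | ⟨y, hy, -⟩
    · exact hne heq
    · exact hy.2.1 hy.2.2

/-- If only one letter is remembered, the cycle-prefix graph is complete. -/
theorem cpRel_of_ne {n : ℕ} {x y : Equiv.Perm (Fin (n + 1)) ⧸ HkSub (n + 1) n}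
    (hxy : x ≠ y) : cpRel (n + 1) n x y := by
  induction x using QuotientGroup.induction_on with | H g => ?_
  induction y using QuotientGroup.induction_on with | H h => ?_
  obtain ⟨h', hp, hE⟩ := exists_permPrefix_eq_moveToFront le_rfl g (h 0)
  have hh : (h' : Equiv.Perm (Fin (n + 1)) ⧸ HkSub (n + 1) n) = h := by
    rw [mk_eq_mk_iff_permPrefix, hp]
    simp [permPrefix, moveToFront, List.finRange_succ]
  rw [hh] at hE
  exact hE.resolve_left hxy.symm

theorem card_quotient_HkSub_self (n : ℕ) :
    Nat.card (Equiv.Perm (Fin (n + 1)) ⧸ HkSub (n + 1) n) = n + 1 := by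
  have hb : Function.Bijective
      fun x : Equiv.Perm (Fin (n + 1)) ⧸ HkSub (n + 1) n => x.out 0 := by
    constructor
    · intro x y hxy
      rw [← QuotientGroup.out_eq' x, ← QuotientGroup.out_eq' y, mk_eq_mk_iff_permPrefix,
        permPrefix_eq_iff]
      intro i hi
      have : i = 0 := Fin.ext (by rw [Fin.val_zero]; omega)
      subst this
      exact hxy
    · intro c
      refine ⟨(Equiv.swap 0 c : Equiv.Perm (Fin (n + 1))), ?_⟩
      have := permPrefix_eq_iff.1 (mk_eq_mk_iff_permPrefix.1
        (QuotientGroup.out_eq'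
          ((Equiv.swap 0 c : Equiv.Perm (Fin (n + 1))) :
            Equiv.Perm (Fin (n + 1)) ⧸ HkSub (n + 1) n))) 0 (by simp)
      simpa using this
  rw [Nat.card_congr (Equiv.ofBijective _ hb), Nat.card_eq_fintype_card, Fintype.card_fin]

end CyclePrefix

/-- The cycle-prefix graph `CP(n,k) = 𝒢(S_n, H_k, {γ(2),…,γ(n−k+1)})` is optimally
vertex connected: `κ(CP(n,k)) = n − 1`. -/
theorem stmt_17 (n k : ℕ) (hn : 2 ≤ n) (hk1 : 1 ≤ k) (hk2 : k ≤ n - 1) :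
    kappa (cayleyRel (HkSub n k)
        {g : Equiv.Perm (Fin n) | ∃ j, 2 ≤ j ∧ j ≤ n - k + 1 ∧ g = gammaPerm n j}) =
      n - 1 := by
  obtain ⟨n, rfl⟩ : ∃ N, n = N + 1 := ⟨n - 1, by omega⟩
  rw [Nat.add_sub_cancel] at hk2 ⊢
  change kappa (cpRel (n + 1) k) = n
  rcases hk2.lt_or_eq with hlt | rfl
  · obtain ⟨T, hTn, hT⟩ := exists_ncard_le_not_SCOn hk1 hlt
    have hex : ∃ T : Set _, ¬ SCOn (cpRel (n + 1) k) Tᶜ := ⟨T, hT⟩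
    rw [kappa, if_pos hex]
    have hmem : T.ncard ∈ {m | ∃ T : Set _, T.ncard = m ∧ ¬ SCOn (cpRel (n + 1) k) Tᶜ} :=
      ⟨T, rfl, hT⟩
    refine le_antisymm ((Nat.sInf_le hmem).trans hTn) (le_csInf ⟨_, hmem⟩ ?_)
    rintro _ ⟨T', rfl, hT'⟩
    exact le_ncard_of_not_SCOn hk2 T' hT'
  · rw [kappa, if_neg, card_quotient_HkSub_self, Nat.add_sub_cancel]
    rintro ⟨T, hT⟩
    refine hT fun a ha b hb => ?_
    by_cases hab : a = b
    · exact hab ▸ Relation.ReflTransGen.refl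
    · exact Relation.ReflTransGen.single ⟨ha, hb, cpRel_of_ne hab⟩
end
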